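/- arXiv:1406.3317 — 3 statements merged into one kernel-verified Lean document; each statement's English description precedes it below -/
import Mathlib

section
/- Let m, n be positive even integers, M a perfect matching of T_{m,n}, and D = D_{m,n}(M). Then every directed cycle C of D has all its corners of the same parity; that is, all vertices of C incident in C to both a horizontal and a vertical edge are simultaneously even (even row and even column) or simultaneously odd. -/
/-- Vertex set of the toroidal grid: `ZMod m × ZMod n`. -/
abbrev TorV (m n : ℕ) := ZMod m × ZMod n

/-- Adjacency in the toroidal grid `T_{m,n}`: equal in one coordinate,
differing by exactly 1 (mod `m` or `n`) in the other. -/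
def torAdj (m n : ℕ) (a b : TorV m n) : Prop :=
  (a.1 = b.1 ∧ (a.2 = b.2 + 1 ∨ b.2 = a.2 + 1)) ∨
  (a.2 = b.2 ∧ (a.1 = b.1 + 1 ∨ b.1 = a.1 + 1))

/-- `M` is a perfect matching of `T_{m,n}`: every element is an edge of the grid,
and every vertex belongs to exactly one element of `M`. -/
def IsPM (m n : ℕ) (M : Finset (Sym2 (TorV m n))) : Prop :=
  (∀ e ∈ M, ∀ a b : TorV m n, e = s(a, b) → torAdj m n a b) ∧
  ∀ v : TorV m n, ∃! e, e ∈ M ∧ v ∈ e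

/-- A vertex `(i,j)` is black when `i + j` is even. -/
def IsBlack {m n : ℕ} (v : TorV m n) : Prop := Even (v.1.val + v.2.val)

/-- `u`, `v`, `w` lie in a common row or a common column. -/
def Collin {m n : ℕ} (u v w : TorV m n) : Prop :=
  (u.1 = v.1 ∧ v.1 = w.1) ∨ (u.2 = v.2 ∧ v.2 = w.2)

/-- The arc relation of the digraph `D_{m,n}(M)`: a black vertex points along its
matching edge; a white vertex `v` with matching edge `uv` points to the neighbor `w`
with `u,v,w` collinear and `vw ∉ M`. -/
def dArc (m n : ℕ) (M : Finset (Sym2 (TorV m n))) (v w : TorV m n) : Prop :=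
  (IsBlack v ∧ torAdj m n v w ∧ s(v, w) ∈ M) ∨
  (¬ IsBlack v ∧ torAdj m n v w ∧ s(v, w) ∉ M ∧ ∃ u, s(u, v) ∈ M ∧ Collin u v w)

/-- A directed cycle of `D_{m,n}(M)`, given by a `k`-periodic sequence of distinct
vertices following arcs of the digraph. -/
def IsDiCycle (m n : ℕ) (M : Finset (Sym2 (TorV m n))) (k : ℕ) (f : ℕ → TorV m n) : Prop :=
  0 < k ∧ (∀ i < k, ∀ j < k, f i = f j → i = j) ∧
  (∀ i, f (i + k) = f i) ∧ ∀ i, dArc m n M (f i) (f (i + 1))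

/-- The underlying undirected edge set `U(C)` of a directed cycle. -/
def cycEdges {m n : ℕ} (k : ℕ) (f : ℕ → TorV m n) : Finset (Sym2 (TorV m n)) :=
  (Finset.range k).image (fun i => s(f i, f (i + 1)))

/-- The vertex set of a directed cycle. -/
def cycVerts {m n : ℕ} (k : ℕ) (f : ℕ → TorV m n) : Finset (TorV m n) :=
  (Finset.range k).image f

/-- The layer `A` of wrap-around vertical edges, between rows `m-1` and `0`. -/
def layerA (m n : ℕ) [NeZero n] : Finset (Sym2 (TorV m n)) :=
  Finset.univ.image (fun j : ZMod n => s(((0 : ZMod m), j), ((-1 : ZMod m), j)))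

/-- The layer `B` of wrap-around horizontal edges, between columns `n-1` and `0`. -/
def layerB (m n : ℕ) [NeZero m] : Finset (Sym2 (TorV m n)) :=
  Finset.univ.image (fun i : ZMod m => s((i, (0 : ZMod n)), (i, (-1 : ZMod n))))

/-- The horizontal edges of row `i`. -/
def rowEdges (m n : ℕ) [NeZero n] (i : ZMod m) : Finset (Sym2 (TorV m n)) :=
  Finset.univ.image (fun j : ZMod n => s((i, j), (i, j + 1)))

/-- The vertical edges of column `j`. -/
def colEdges (m n : ℕ) [NeZero m] (j : ZMod n) : Finset (Sym2 (TorV m n)) :=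
  Finset.univ.image (fun i : ZMod m => s((i, j), (i + 1, j)))

/-- The vertex `f (i+1)` of the cycle `f` is a corner: one of the two incident
cycle edges is horizontal (endpoints in the same row) and the other is vertical. -/
def CornerAt {m n : ℕ} (f : ℕ → TorV m n) (i : ℕ) : Prop :=
  ¬ (((f i).1 = (f (i + 1)).1) ↔ ((f (i + 1)).1 = (f (i + 2)).1))

/-- Parity of a residue modulo an even number. -/
noncomputable def par {m : ℕ} (x : ZMod m) : ZMod 2 := (x.val : ZMod 2)

theorem par_eq_cast {m : ℕ} [NeZero m] (x : ZMod m) : par x = (ZMod.cast x : ZMod 2) := by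
  rw [par, ZMod.natCast_val]

theorem par_succ {m : ℕ} [NeZero m] (hm : Even m) (x : ZMod m) : par (x + 1) = par x + 1 := by
  rw [par_eq_cast, par_eq_cast, ZMod.cast_add hm.two_dvd, ZMod.cast_one hm.two_dvd]

theorem par_even {m : ℕ} (x : ZMod m) : par x = 0 ↔ Even x.val := by
  rw [par, ZMod.natCast_eq_zero_iff_even]

theorem par_odd {m : ℕ} (x : ZMod m) : par x = 1 ↔ Odd x.val := by
  rw [par, ZMod.natCast_eq_one_iff_odd]

theorem black_iff {m n : ℕ} (v : TorV m n) : IsBlack v ↔ par v.1 = par v.2 := by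
  have h : ∀ a b : ZMod 2, a + b = 0 ↔ a = b := by decide
  rw [IsBlack, ← ZMod.natCast_eq_zero_iff_even, Nat.cast_add, h]; rfl

theorem adj_par {m n : ℕ} [NeZero m] [NeZero n] (hm : Even m) (hn : Even n)
    {a b : TorV m n} (h : torAdj m n a b) :
    (a.1 = b.1 ∧ par b.2 = par a.2 + 1) ∨ (a.2 = b.2 ∧ par b.1 = par a.1 + 1) := by
  have h2 : ∀ a : ZMod 2, a = a + 1 + 1 := by decide
  rcases h with ⟨h, h' | h'⟩ | ⟨h, h' | h'⟩
  · left; refine ⟨h, ?_⟩; rw [h', par_succ hn]; exact h2 _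
  · left; refine ⟨h, ?_⟩; rw [h', par_succ hn]
  · right; refine ⟨h, ?_⟩; rw [h', par_succ hm]; exact h2 _
  · right; refine ⟨h, ?_⟩; rw [h', par_succ hm]

theorem arc_adj {m n : ℕ} {M : Finset (Sym2 (TorV m n))} {a b : TorV m n}
    (h : dArc m n M a b) : torAdj m n a b := by
  rcases h with h | h
  · exact h.2.1
  · exact h.2.1

theorem arc_black {m n : ℕ} [NeZero m] [NeZero n] (hm : Even m) (hn : Even n)
    {M : Finset (Sym2 (TorV m n))} {a b : TorV m n}
    (h : dArc m n M a b) : IsBlack b ↔ ¬ IsBlack a := by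
  have h1 : ∀ x y : ZMod 2, x = y + 1 ↔ ¬ x = y := by decide
  have h2 : ∀ x y : ZMod 2, x + 1 = y ↔ ¬ x = y := by decide
  rw [black_iff, black_iff]
  rcases adj_par hm hn (arc_adj h) with ⟨h, h'⟩ | ⟨h, h'⟩
  · rw [h', ← h]; exact h1 _ _
  · rw [h', ← h]; exact h2 _ _

theorem arc_collin {m n : ℕ} [NeZero m] [NeZero n] (hm : Even m) (hn : Even n)
    {M : Finset (Sym2 (TorV m n))} (hM : IsPM m n M) {a b c : TorV m n}
    (hab : dArc m n M a b) (hbc : dArc m n M b c) (ha : IsBlack a) : Collin a b c := by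
  have hb : ¬ IsBlack b := fun h => (arc_black hm hn hab).1 h ha
  rcases hab with ⟨-, -, h1⟩ | h
  · rcases hbc with h | ⟨-, -, -, u, hu, hcol⟩
    · exact absurd h.1 hb
    · have := (hM.2 b).unique ⟨h1, Sym2.mem_mk_right _ _⟩ ⟨hu, Sym2.mem_mk_right _ _⟩
      rw [Sym2.congr_left] at this
      rw [this]; exact hcol
  · exact absurd ha h.1

theorem adj_ne {m n : ℕ} [NeZero m] [NeZero n] (hm : Even m) (hn : Even n)
    {a b : TorV m n} (h : torAdj m n a b) :
    (a.1 = b.1 ∧ a.2 ≠ b.2 ∧ par b.2 = par a.2 + 1) ∨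
    (a.2 = b.2 ∧ a.1 ≠ b.1 ∧ par b.1 = par a.1 + 1) := by
  have h1 : ∀ x : ZMod 2, x ≠ x + 1 := by decide
  rcases adj_par hm hn h with ⟨h, h'⟩ | ⟨h, h'⟩
  · exact Or.inl ⟨h, fun e => h1 (par a.2) (by rw [← h', e]), h'⟩
  · exact Or.inr ⟨h, fun e => h1 (par a.1) (by rw [← h', e]), h'⟩

theorem collin_step {m n : ℕ} [NeZero m] [NeZero n] (hm : Even m) (hn : Even n)
    {a b c : TorV m n} (hab : torAdj m n a b) (hbc : torAdj m n b c) (h : Collin a b c) :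
    (a.1 = b.1 ↔ b.1 = c.1) ∧ par c.1 = par a.1 := by
  have h2 : ∀ a : ZMod 2, a + 1 + 1 = a := by decide
  rcases h with ⟨h1, h3⟩ | ⟨h1, h3⟩
  · exact ⟨by simp [h1, h3], by rw [h1, h3]⟩
  · rcases adj_ne hm hn hab with h | ⟨-, h4, h5⟩
    · exact absurd h1 h.2.1
    rcases adj_ne hm hn hbc with h | ⟨-, h6, h7⟩
    · exact absurd h3 h.2.1
    exact ⟨by simp [h4, h6], by rw [h7, h5, h2]⟩

/-- every directed cycle of `D_{m,n}(M)` has all its corners of the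
same parity: all corners are even vertices (even row and even column) or all are
odd vertices. -/
theorem dicycle_corners_same_parity (m n : ℕ) [NeZero m] [NeZero n]
    (hm : Even m) (hn : Even n)
    (M : Finset (Sym2 (TorV m n))) (hM : IsPM m n M)
    (k : ℕ) (f : ℕ → TorV m n) (hc : IsDiCycle m n M k f) :
    (∀ i, CornerAt f i → Even (f (i + 1)).1.val ∧ Even (f (i + 1)).2.val) ∨
    (∀ i, CornerAt f i → Odd (f (i + 1)).1.val ∧ Odd (f (i + 1)).2.val) := by
  obtain ⟨-, -, -, harc⟩ := hc
  have hcol : ∀ i, IsBlack (f i) → (((f i).1 = (f (i + 1)).1) ↔ ((f (i + 1)).1 = (f (i + 2)).1)) ∧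
      par (f (i + 2)).1 = par (f i).1 := fun i hi =>
    collin_step hm hn (arc_adj (harc i)) (arc_adj (harc (i + 1)))
      (arc_collin hm hn hM (harc i) (harc (i + 1)) hi)
  have hflip : ∀ i, IsBlack (f (i + 1)) ↔ ¬ IsBlack (f i) := fun i => arc_black hm hn (harc i)
  have hinv : ∃ s : ZMod 2, ∀ i, (IsBlack (f i) → par (f i).1 = s) ∧
      (¬ IsBlack (f i) → par (f (i + 1)).1 = s) := by
    have hstep : ∀ s : ZMod 2, ∀ i, ((IsBlack (f i) → par (f i).1 = s) ∧
        (¬ IsBlack (f i) → par (f (i + 1)).1 = s)) →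
        ((IsBlack (f (i + 1)) → par (f (i + 1)).1 = s) ∧
        (¬ IsBlack (f (i + 1)) → par (f (i + 1 + 1)).1 = s)) := by
      rintro s i ⟨h1, h2⟩
      refine ⟨fun h => h2 ((hflip i).1 h), fun h => ?_⟩
      have hb : IsBlack (f i) := by
        by_contra hb
        exact h ((hflip i).2 hb)
      exact (hcol i hb).2.trans (h1 hb)
    by_cases h0 : IsBlack (f 0)
    · refine ⟨par (f 0).1, fun i => ?_⟩
      induction i with
      | zero => exact ⟨fun _ => rfl, fun h => absurd h0 h⟩
      | succ i ih => exact hstep _ i ih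
    · refine ⟨par (f 1).1, fun i => ?_⟩
      induction i with
      | zero => exact ⟨fun h => absurd h h0, fun _ => rfl⟩
      | succ i ih => exact hstep _ i ih
  obtain ⟨s, hs⟩ := hinv
  have hcorner : ∀ i, CornerAt f i → par (f (i + 1)).1 = s ∧ par (f (i + 1)).2 = s := by
    intro i hi
    have hb : IsBlack (f (i + 1)) := (hflip i).2 fun h => hi (hcol i h).1
    have h1 := (hs (i + 1)).1 hb
    exact ⟨h1, ((black_iff _).1 hb).symm.trans h1⟩
  have h01 : ∀ s : ZMod 2, s = 0 ∨ s = 1 := by decide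
  rcases h01 s with rfl | rfl
  · left
    intro i hi
    exact ⟨(par_even _).1 (hcorner i hi).1, (par_even _).1 (hcorner i hi).2⟩
  · right
    intro i hi
    exact ⟨(par_odd _).1 (hcorner i hi).1, (par_odd _).1 (hcorner i hi).2⟩
end

section
/- Let m, n be positive even integers and M a perfect matching of T_{m,n}. Let A be the set of vertical edges between rows m-1 and 0, and B the set of horizontal edges between columns n-1 and 0. Then no directed cycle C of D_{m,n}(M) has both |U(C) ∩ A| and |U(C) ∩ B| even. -/
namespace EE
open Equiv

abbrev G (p q : ℕ) := ZMod p × ZMod q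

section coarse
variable {p q : ℕ}

/-- Unit vector of a direction. -/
def dirv (p q : ℕ) (d : Fin 4) : G p q :=
  match d with
  | 0 => (1, 0)
  | 1 => (0, 1)
  | 2 => (-1, 0)
  | 3 => (0, -1)

/-- Offset of the face to the left of a dart. -/
def offF (p q : ℕ) (d : Fin 4) : G p q :=
  match d with
  | 0 => 0
  | 1 => (-1, 0)
  | 2 => (-1, -1)
  | 3 => (0, -1)

/-- Offset of the base point of the edge of a dart. -/
def offE (p q : ℕ) (d : Fin 4) : G p q :=
  match d with
  | 0 => 0
  | 1 => 0
  | 2 => (-1, 0)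
  | 3 => (0, -1)

def shiftEq (o : Fin 4 → G p q) : (G p q × Fin 4) ≃ (G p q × Fin 4) where
  toFun y := (y.1 + o y.2, y.2)
  invFun y := (y.1 - o y.2, y.2)
  left_inv y := by simp
  right_inv y := by simp

def PP (o : Fin 4 → G p q) (π : G p q → Perm (Fin 4)) : Perm (G p q × Fin 4) :=
  ((shiftEq o).trans (prodCongrRight π)).trans (shiftEq o).symm

theorem PP_apply (o : Fin 4 → G p q) (π : G p q → Perm (Fin 4)) (x : G p q) (d : Fin 4) :
    PP o π (x, d) = (x + o d - o (π (x + o d) d), π (x + o d) d) := by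
  simp [PP, shiftEq]

theorem PP_inv_apply (o : Fin 4 → G p q) (π : G p q → Perm (Fin 4)) (x : G p q) (d : Fin 4) :
    (PP o π)⁻¹ (x, d) = (x + o d - o ((π (x + o d))⁻¹ d), (π (x + o d))⁻¹ d) := by
  rw [Perm.inv_eq_iff_eq, PP_apply]
  simp

theorem PP_sign [NeZero p] [NeZero q] (o : Fin 4 → G p q) (π : G p q → Perm (Fin 4)) :
    Perm.sign (PP o π) = ∏ x, Perm.sign (π x) := by
  have := Perm.sign_symm_trans_trans (prodCongrRight π) (shiftEq o).symm
  rw [Perm.sign_prodCongrRight] at this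
  rw [← this]; rfl

def rot : Perm (Fin 4) := Equiv.addRight 1

theorem rot_sign : Perm.sign rot = -1 := by decide

def Vin (s : G p q → Bool) (x : G p q) : Bool :=
  s x && s (x + (-1, 0)) && s (x + (-1, -1)) && s (x + (0, -1))
def E0in (s : G p q → Bool) (x : G p q) : Bool := s x && s (x + (0, -1))
def E1in (s : G p q → Bool) (x : G p q) : Bool := s x && s (x + (-1, 0))

def vπ (s : G p q → Bool) (x : G p q) : Perm (Fin 4) := if Vin s x then rot else 1
def fπ (s : G p q → Bool) (x : G p q) : Perm (Fin 4) := if s x then rot else 1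
def eπ (s : G p q → Bool) (x : G p q) : Perm (Fin 4) :=
  (if E0in s x then swap 0 2 else 1) * (if E1in s x then swap 1 3 else 1)

def rho (s : G p q → Bool) : Perm (G p q × Fin 4) :=
  (PP 0 (vπ s))⁻¹ * PP (offE p q) (eπ s) * (PP (offF p q) (fπ s))⁻¹

theorem sign_prod [NeZero p] [NeZero q] (v : G p q → Bool) :
    ∏ x, (if v x then (-1 : ℤˣ) else 1) = (-1) ^ (Finset.univ.filter (fun x => v x = true)).card := by
  rw [Finset.prod_ite]; simp

theorem rho_sign [NeZero p] [NeZero q] (s : G p q → Bool) :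
    Perm.sign (rho s) = (-1) ^ ((Finset.univ.filter (fun x => Vin s x = true)).card
      + (Finset.univ.filter (fun x => E0in s x = true)).card
      + (Finset.univ.filter (fun x => E1in s x = true)).card
      + (Finset.univ.filter (fun x => s x = true)).card) := by
  have hv : ∀ x, Perm.sign (vπ s x) = if Vin s x then -1 else 1 := by
    intro x; unfold vπ; split_ifs <;> simp [rot_sign]
  have hf : ∀ x, Perm.sign (fπ s x) = if s x then -1 else 1 := by
    intro x; unfold fπ; split_ifs <;> simp [rot_sign]
  have he : ∀ x, Perm.sign (eπ s x) = (if E0in s x then -1 else 1) * (if E1in s x then -1 else 1) := by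
    intro x; unfold eπ; split_ifs <;> simp
  simp only [rho, Perm.sign_mul, Perm.sign_inv, PP_sign, hv, hf, he, Finset.prod_mul_distrib, sign_prod]
  rw [pow_add, pow_add, pow_add]
  ac_rfl

/-- Left face of a dart is in `s`. -/
def inK (s : G p q → Bool) (x : G p q) (d : Fin 4) : Bool := s (x + offF p q d)

theorem Vin_iff (s : G p q → Bool) (x : G p q) : Vin s x = true ↔ ∀ d, inK s x d = true := by
  simp only [Vin, inK, Fin.forall_fin_succ, offF]
  simp [Fin.succ]
  tauto

theorem vec1 (d : Fin 4) : offF p q d - offF p q (d - 1) = dirv p q (d + 1) := by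
  fin_cases d <;> ext <;> simp [offF, dirv, show (-1 : Fin 4) = 3 from rfl]
theorem vec2 (d : Fin 4) : dirv p q (d + 1) + dirv p q (d - 1) = 0 := by
  fin_cases d <;> ext <;> simp [dirv, show (-1 : Fin 4) = 3 from rfl]
theorem vec2' (d : Fin 4) : dirv p q (d + 2) = - dirv p q d := by
  fin_cases d <;> ext <;> simp [dirv]

theorem PPE_apply (s : G p q → Bool) (x : G p q) (d : Fin 4) :
    PP (offE p q) (eπ s) (x, d) =
      if inK s x d && inK s (x + dirv p q d) (d + 2) then (x + dirv p q d, d + 2) else (x, d) := by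
  have key : eπ s (x + offE p q d) d =
      if inK s x d && inK s (x + dirv p q d) (d + 2) then d + 2 else d := by
    have h0 : eπ s (x + offE p q d) 0 = if E0in s (x + offE p q d) then 2 else 0 := by
      unfold eπ; split_ifs <;> simp [swap_apply_def]
    have h1 : eπ s (x + offE p q d) 1 = if E1in s (x + offE p q d) then 3 else 1 := by
      unfold eπ; split_ifs <;> simp [swap_apply_def]
    have h2 : eπ s (x + offE p q d) 2 = if E0in s (x + offE p q d) then 0 else 2 := by
      unfold eπ; split_ifs <;> simp [swap_apply_def]
    have h3 : eπ s (x + offE p q d) 3 = if E1in s (x + offE p q d) then 1 else 3 := by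
      unfold eπ; split_ifs <;> simp [swap_apply_def]
    fin_cases d
    · refine h0.trans ?_
      simp [E0in, inK, offE, offF, dirv, add_assoc]
    · refine h1.trans ?_
      simp [E1in, inK, offE, offF, dirv, add_assoc, and_comm, Prod.mk_zero_zero]
    · refine h2.trans ?_
      simp [E0in, inK, offE, offF, dirv, add_assoc, and_comm]
    · refine h3.trans ?_
      simp [E1in, inK, offE, offF, dirv, add_assoc]
  rw [PP_apply, key]
  split_ifs
  · congr 1
    fin_cases d <;> ext <;> simp [offE, dirv, sub_eq_add_neg]
  · simp

theorem rho_of_not (s : G p q → Bool) (x : G p q) (d : Fin 4) (h : inK s x d = false) :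
    rho s (x, d) = (x, d) := by
  have hV : Vin s x = false := by
    by_contra hh
    have := (Vin_iff s x).1 (by simpa using hh) d
    simp [this] at h
  simp only [rho, Perm.mul_apply]
  rw [PP_inv_apply (offF p q)]
  have : fπ s (x + offF p q d) = 1 := by unfold fπ; unfold inK at h; simp [h]
  rw [this, inv_one, Perm.one_apply, add_sub_cancel_right]
  rw [PPE_apply, h, PP_inv_apply]
  simp [vπ, hV]

theorem rot_inv (d : Fin 4) : rot⁻¹ d = d - 1 := by
  rw [Perm.inv_eq_iff_eq]; simp [rot]

theorem inK_arr (s : G p q → Bool) (x : G p q) (d : Fin 4) :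
    inK s (x + dirv p q (d + 1)) (d - 1) = inK s x d := by
  unfold inK
  rw [← vec1]; congr 1; abel

theorem step1 (s : G p q → Bool) (x : G p q) (d : Fin 4) (h : inK s x d = true) :
    (PP (offE p q) (eπ s) * (PP (offF p q) (fπ s))⁻¹) (x, d) =
      if inK s x (d + 1) then (x, d + 1) else (x + dirv p q (d + 1), d - 1) := by
  simp only [Perm.mul_apply]
  rw [PP_inv_apply]
  have h1 : fπ s (x + offF p q d) = rot := by unfold fπ; unfold inK at h; simp [h]
  rw [h1, rot_inv, PPE_apply, add_sub_assoc, vec1]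
  have e1 : x + dirv p q (d + 1) + dirv p q (d - 1) = x := by
    rw [add_assoc, vec2, add_zero]
  have e2 : d - 1 + 2 = d + 1 := by clear * -; revert d; decide
  rw [e1, e2, inK_arr, h]
  simp

theorem rho_Vin (s : G p q → Bool) (x : G p q) (d : Fin 4) (h : Vin s x = true) :
    rho s (x, d) = (x, d) := by
  have h' := (Vin_iff s x).1 h
  rw [rho, mul_assoc, Perm.mul_apply, step1 s x d (h' d), h' (d + 1), if_pos rfl, PP_inv_apply]
  simp [vπ, h, rot_inv]

theorem rho_bd (s : G p q → Bool) (x : G p q) (d : Fin 4) (h : inK s x d = true)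
    (hV : Vin s x = false) :
    rho s (x, d) = if inK s x (d + 1) then (x, d + 1) else (x + dirv p q (d + 1), d - 1) := by
  rw [rho, mul_assoc, Perm.mul_apply, step1 s x d h]
  split_ifs with h1
  · rw [PP_inv_apply]; simp [vπ, hV]
  · have : Vin s (x + dirv p q (d + 1)) = false := by
      by_contra hh
      have := (Vin_iff s _).1 (by simpa using hh) (d - 1 - 1)
      apply h1
      rw [← this]
      have e := inK_arr s (x + dirv p q (d + 1)) (d - 1 - 1)
      have e3 : d - 1 - 1 + 1 = d - 1 := by simp
      rw [e3, add_assoc, vec2, add_zero] at e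
      rw [← e]
      congr 1
      clear * -; revert d; decide
    rw [PP_inv_apply]; simp [vπ, this]

theorem rho_support [NeZero p] [NeZero q] (s : G p q → Bool) (x : G p q) (d : Fin 4) :
    rho s (x, d) ≠ (x, d) ↔ inK s x d = true ∧ Vin s x = false := by
  constructor
  · intro h
    constructor
    · by_contra hh; exact h (rho_of_not s x d (by simpa using hh))
    · by_contra hh; exact h (rho_Vin s x d (by simpa using hh))
  · rintro ⟨h1, h2⟩
    rw [rho_bd s x d h1 h2]
    split_ifs
    · simp
    · simp

theorem rho_support_card [NeZero p] [NeZero q] (s : G p q → Bool) :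
    Even (rho s).support.card := by
  have hK : (Finset.univ.filter (fun y : G p q × Fin 4 => inK s y.1 y.2 = true)).card
      = (Finset.univ.filter (fun x : G p q => s x = true)).card * 4 := by
    have : ((Finset.univ.filter (fun x : G p q => s x = true)) ×ˢ (Finset.univ : Finset (Fin 4))).card
      = (Finset.univ.filter (fun x : G p q => s x = true)).card * 4 := by
      rw [Finset.card_product]; simp
    rw [← this]
    refine Finset.card_equiv (shiftEq (offF p q)) ?_
    rintro ⟨x, d⟩
    rw [Finset.mem_filter, Finset.mem_product, Finset.mem_filter]
    simp [inK, shiftEq]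
  have hV : (Finset.univ.filter (fun y : G p q × Fin 4 => Vin s y.1 = true)).card
      = (Finset.univ.filter (fun x : G p q => Vin s x = true)).card * 4 := by
    have : ((Finset.univ.filter (fun x : G p q => Vin s x = true)) ×ˢ (Finset.univ : Finset (Fin 4))).card
      = (Finset.univ.filter (fun x : G p q => Vin s x = true)).card * 4 := by
      rw [Finset.card_product]; simp
    rw [← this]
    congr 1
    ext ⟨x, d⟩
    simp
  have hU : (rho s).support.card
      + (Finset.univ.filter (fun y : G p q × Fin 4 => Vin s y.1 = true)).card
      = (Finset.univ.filter (fun y : G p q × Fin 4 => inK s y.1 y.2 = true)).card := by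
    rw [← Finset.card_union_of_disjoint]
    · congr 1
      ext ⟨x, d⟩
      simp only [Finset.mem_union, Perm.mem_support, rho_support, Finset.mem_filter,
        Finset.mem_univ, true_and]
      have := (Vin_iff s x)
      constructor
      · rintro (h | h)
        · exact h.1
        · exact this.1 h d
      · intro h
        cases hh : Vin s x
        · left; exact ⟨h, rfl⟩
        · right; rfl
    · rw [Finset.disjoint_left]
      rintro ⟨x, d⟩
      simp only [Perm.mem_support, rho_support, Finset.mem_filter,
        Finset.mem_univ, true_and]
      rintro ⟨_, h⟩; simp [h]
  rw [Nat.even_iff]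
  omega

theorem odd_of_cycle [NeZero p] [NeZero q] (s : G p q → Bool) (h : (rho s).IsCycle) :
    Odd ((Finset.univ.filter (fun x => Vin s x = true)).card
      + (Finset.univ.filter (fun x => E0in s x = true)).card
      + (Finset.univ.filter (fun x => E1in s x = true)).card
      + (Finset.univ.filter (fun x => s x = true)).card) := by
  have h1 := rho_sign s
  rw [h.sign, (rho_support_card s).neg_one_pow] at h1
  by_contra hh
  rw [Nat.not_odd_iff_even] at hh
  rw [hh.neg_one_pow] at h1
  exact absurd h1 (by decide)

structure CC (p q L : ℕ) (x : ℕ → G p q) (d : ℕ → Fin 4) : Prop where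
  pos : 0 < L
  per : ∀ t, x (t + L) = x t
  dper : ∀ t, d (t + L) = d t
  inj : ∀ a b, x a = x b → a ≡ b [MOD L]
  step : ∀ t, x (t + 1) = x t + dirv p q (d t)
  turn : ∀ t, d (t + 1) ≠ d t + 2

def cd (x : ℕ → G p q) (d : ℕ → Fin 4) (y : G p q) (e : Fin 4) : Prop :=
  ∃ t, (y = x t ∧ e = d t) ∨ (y = x (t + 1) ∧ e = d t + 2)

theorem per_mod {α : Type*} {L : ℕ} {g : ℕ → α} (h : ∀ t, g (t + L) = g t) {a b : ℕ}
    (hab : a ≡ b [MOD L]) : g a = g b := by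
  have hp : Function.Periodic g L := h
  rw [← hp.map_mod_nat a, ← hp.map_mod_nat b, hab]

variable {L : ℕ} {x : ℕ → G p q} {d : ℕ → Fin 4}

theorem CC.cd_iff (h : CC p q L x d) (t : ℕ) (e : Fin 4) :
    cd x d (x (t + 1)) e ↔ e = d (t + 1) ∨ e = d t + 2 := by
  constructor
  · rintro ⟨t', ⟨h1, h2⟩ | ⟨h1, h2⟩⟩
    · left; rw [h2]; exact per_mod h.dper (h.inj _ _ h1).symm
    · right; rw [h2]; rw [per_mod h.dper (Nat.ModEq.add_right_cancel' 1 (h.inj _ _ h1))]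
  · rintro (rfl | rfl)
    · exact ⟨t + 1, Or.inl ⟨rfl, rfl⟩⟩
    · exact ⟨t, Or.inr ⟨rfl, rfl⟩⟩

theorem CC.on (h : CC p q L x d) (t : ℕ) : ∃ t', x t = x (t' + 1) := by
  refine ⟨t + (L - 1), ?_⟩
  rw [add_assoc, Nat.sub_add_cancel h.pos, h.per]

def Jump (s : G p q → Bool) (x : ℕ → G p q) (d : ℕ → Fin 4) : Prop :=
  ∀ y e, inK s y e ≠ inK s y (e - 1) ↔ cd x d y e

theorem arc_facts : ∀ (K : Fin 4 → Bool) (u w : Fin 4), K u = true → K (u - 1) = false →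
    K w ≠ K (w - 1) → (∀ e, e ≠ u → e ≠ w → K e = K (e - 1)) → u ≠ w →
    K (w - 1) = true ∧ K w = false ∧ ∀ e, K e = true → e ≠ u → K (e - 1) = true := by
  decide

theorem rho_cycle [NeZero p] [NeZero q] (h : CC p q L x d) (s : G p q → Bool) (hJ : Jump s x d)
    (h0 : inK s (x 0) (d 0) = true) : (rho s).IsCycle := by
  have hP : ∀ t, inK s (x t) (d t) = true → inK s (x t) (d t - 1) = false := by
    intro t ht
    have := (hJ (x t) (d t)).2 ⟨t, Or.inl ⟨rfl, rfl⟩⟩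
    rw [ht] at this
    simpa using this.symm
  have hVf : ∀ t, inK s (x t) (d t) = true → Vin s (x t) = false := by
    intro t ht
    by_contra hh
    have := (Vin_iff s _).1 (by simpa using hh) (d t - 1)
    rw [hP t ht] at this; simp at this
  have sc : ∀ y : G p q × Fin 4, (rho s).SameCycle y (rho s y) := fun y => ⟨1, by simp⟩
  have main : ∀ t, inK s (x (t + 1)) (d (t + 1)) = true →
      inK s (x t) (d t) = true ∧
      (∀ e, inK s (x (t + 1)) e = true → (rho s).SameCycle (x (t + 1), d (t + 1)) (x (t + 1), e)) ∧
      (rho s).SameCycle (x (t + 1), d (t + 1)) (x t, d t) := by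
    intro t ht
    have hV := hVf _ ht
    obtain ⟨a1, a2, a3⟩ := arc_facts (inK s (x (t + 1))) (d (t + 1)) (d t + 2) ht (hP _ ht)
      ((hJ _ _).2 ((h.cd_iff _ _).2 (Or.inr rfl)))
      (by
        intro e he1 he2
        by_contra hh
        have := (h.cd_iff _ _).1 ((hJ _ _).1 hh)
        tauto) (h.turn t)
    have e1 : d t + 2 - 1 + 1 = d t + 2 := by simp
    have e2 : d t + 2 - 1 - 1 = d t := by clear * -; generalize d t = z; revert z; decide
    have e3 : x (t + 1) + dirv p q (d t + 2) = x t := by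
      rw [vec2', h.step]; simp
    have r : rho s (x (t + 1), d t + 2 - 1) = (x t, d t) := by
      rw [rho_bd s _ _ a1 hV, e1, e2, e3, a2]; simp
    have i := inK_arr s (x (t + 1)) (d t + 2 - 1)
    rw [e1, e2, e3, a1] at i
    have st : ∀ e, inK s (x (t + 1)) e = true → e ≠ d (t + 1) →
        (rho s).SameCycle (x (t + 1), e - 1) (x (t + 1), e) := by
      intro e he hu
      have := sc (x (t + 1), e - 1)
      rw [rho_bd s _ _ (a3 e he hu) hV] at this
      simpa [he] using this
    have all : ∀ e, inK s (x (t + 1)) e = true →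
        (rho s).SameCycle (x (t + 1), d (t + 1)) (x (t + 1), e) := by
      intro e he
      by_cases c0 : e = d (t + 1)
      · rw [c0]
      refine Perm.SameCycle.trans ?_ (st e he c0)
      have he := a3 e he c0
      by_cases c1 : e - 1 = d (t + 1)
      · rw [c1]
      refine Perm.SameCycle.trans ?_ (st _ he c1)
      have he := a3 _ he c1
      by_cases c2 : e - 1 - 1 = d (t + 1)
      · rw [c2]
      refine Perm.SameCycle.trans ?_ (st _ he c2)
      have c3 : e - 1 - 1 - 1 = d (t + 1) := by
        clear * - c0 c1 c2
        generalize d (t + 1) = z at *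
        revert e z; decide
      rw [c3]
    refine ⟨i, all, ?_⟩
    have := (all _ a1).trans (sc _)
    rwa [r] at this
  have desc : ∀ j t, (inK s (x (t + j)) (d (t + j)) = true ∧
      (rho s).SameCycle (x 0, d 0) (x (t + j), d (t + j))) →
      (inK s (x t) (d t) = true ∧ (rho s).SameCycle (x 0, d 0) (x t, d t)) := by
    intro j
    induction j with
    | zero => intro t ht; exact ht
    | succ j ih =>
      intro t ht
      apply ih
      obtain ⟨b1, b2⟩ := ht
      rw [← add_assoc] at b1 b2
      have := main _ b1
      exact ⟨this.1, b2.trans this.2.2⟩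
  have all : ∀ t, inK s (x t) (d t) = true ∧ (rho s).SameCycle (x 0, d 0) (x t, d t) := by
    intro t
    have e : t + (L * t - t) ≡ 0 [MOD L] := by
      have : t ≤ L * t := Nat.le_mul_of_pos_left t h.pos
      rw [Nat.add_sub_cancel' this]
      simp [Nat.ModEq]
    refine desc (L * t - t) t ?_
    rw [per_mod h.per e, per_mod h.dper e]
    exact ⟨h0, Perm.SameCycle.refl _ _⟩
  refine ⟨(x 0, d 0), (rho_support s _ _).2 ⟨h0, hVf 0 h0⟩, ?_⟩
  rintro ⟨y, e⟩ hy
  obtain ⟨y1, y2⟩ := (rho_support s _ _).1 hy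
  have : ∃ e', cd x d y e' := by
    by_contra hh
    push Not at hh
    have hh' : ∀ e', inK s y e' = inK s y (e' - 1) := fun e' => by
      by_contra h'; exact hh e' ((hJ y e').1 h')
    have : ∀ e', inK s y e' = true := by
      have aux : ∀ (K : Fin 4 → Bool), (∀ e', K e' = K (e' - 1)) → ∀ e, K e = true → ∀ e', K e' = true := by
        decide
      exact aux _ hh' e y1
    rw [← Vin_iff] at this
    simp [this] at y2
  have : ∃ t, y = x (t + 1) := by
    obtain ⟨e', t, ⟨h1, -⟩ | ⟨h1, -⟩⟩ := this
    · rw [h1]; exact h.on t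
    · exact ⟨t, h1⟩
  obtain ⟨t, rfl⟩ := this
  exact (all (t + 1)).2.trans ((main t (all _).1).2.1 e y1)

theorem jump_not (s : G p q → Bool) (hJ : Jump s x d) : Jump (fun y => !(s y)) x d := by
  intro y e
  rw [← hJ y e]
  simp [inK]

theorem exists_odd [NeZero p] [NeZero q] (h : CC p q L x d) (s : G p q → Bool) (hJ : Jump s x d) :
    ∃ s : G p q → Bool, Jump s x d ∧ 
      Odd ((Finset.univ.filter (fun x => Vin s x = true)).card
      + (Finset.univ.filter (fun x => E0in s x = true)).card
      + (Finset.univ.filter (fun x => E1in s x = true)).card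
      + (Finset.univ.filter (fun x => s x = true)).card) := by
  cases hh : inK s (x 0) (d 0)
  · refine ⟨_, jump_not s hJ, odd_of_cycle _ (rho_cycle h _ (jump_not s hJ) ?_)⟩
    simpa [inK] using hh
  · exact ⟨s, hJ, odd_of_cycle _ (rho_cycle h _ hJ hh)⟩

/-- One dimensional integration. -/
theorem integ (p : ℕ) [NeZero p] (g : ZMod p → ZMod 2) (h : ∑ i, g i = 0) (i0 : ZMod p) :
    ∃ F : ZMod p → ZMod 2, F i0 = 0 ∧ ∀ i, F i = F (i - 1) + g i := by
  have hs : ∑ i ∈ Finset.range p, g (i : ZMod p) = 0 := by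
    rw [← h]
    refine Finset.sum_bij (fun i _ => (i : ZMod p)) (by simp) ?_ ?_ (by simp)
    · intro a ha b hb hab
      simp only [Finset.mem_range] at ha hb
      have := congrArg ZMod.val hab
      rwa [ZMod.val_natCast_of_lt ha, ZMod.val_natCast_of_lt hb] at this
    · intro b _
      exact ⟨b.val, by simp [ZMod.val_lt], by simp⟩
  let F0 : ZMod p → ZMod 2 := fun i => ∑ j ∈ Finset.range (i.val + 1), g (j : ZMod p)
  have hF0 : ∀ i, F0 i = F0 (i - 1) + g i := by
    intro i
    by_cases hi : i = 0
    · subst hi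
      have e : (0 - 1 : ZMod p).val + 1 = p := by
        obtain ⟨r, rfl⟩ : ∃ r, p = r + 1 := ⟨p - 1, by have := NeZero.pos p; omega⟩
        rw [zero_sub, ZMod.val_neg_one]
      simp only [F0]
      rw [e, hs]; simp
    · have e : (i - 1).val + 1 = i.val := by
        have h1 : 0 < i.val := Nat.pos_of_ne_zero (by simpa using hi)
        have h2 := ZMod.val_lt i
        have : i - 1 = ((i.val - 1 : ℕ) : ZMod p) := by
          rw [Nat.cast_sub h1]; simp
        rw [this, ZMod.val_natCast_of_lt (by omega)]; omega
      simp only [F0]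
      rw [Finset.sum_range_succ, e]; simp
  refine ⟨fun i => F0 i - F0 i0, by simp, fun i => ?_⟩
  show F0 i - F0 i0 = F0 (i - 1) - F0 i0 + g i
  rw [hF0 i]; ring

theorem const_of_step (p : ℕ) [NeZero p] (g : ZMod p → ZMod 2) (h : ∀ i, g i = g (i - 1)) (i j : ZMod p) :
    g i = g j := by
  have : ∀ k : ℕ, g k = g 0 := by
    intro k
    induction k with
    | zero => simp
    | succ k ih => rw [h, ← ih]; simp
  have a := this i.val
  have b := this j.val
  simp at a b
  rw [a, b]

theorem poincare [NeZero p] [NeZero q] (c0 c1 : ZMod p → ZMod q → ZMod 2)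
    (hz : ∀ i j, c0 i j + c0 (i - 1) j + c1 i j + c1 i (j - 1) = 0)
    (i0 : ZMod p) (j0 : ZMod q) (h0 : ∑ j, c0 i0 j = 0) (h1 : ∑ i, c1 i j0 = 0) :
    ∃ s : ZMod p → ZMod q → ZMod 2, ∀ i j, s i j = s i (j - 1) + c0 i j ∧ s i j = s (i - 1) j + c1 i j := by
  have two : ∀ a : ZMod 2, a + a = 0 := by decide
  have h0' : ∀ i, ∑ j, c0 i j = 0 := by
    intro i
    rw [← h0]
    refine const_of_step p (fun i => ∑ j, c0 i j) ?_ i i0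
    intro i
    have h2 : ∑ j, (c0 i j + c0 (i - 1) j + c1 i j + c1 i (j - 1)) = 0 := by simp [hz]
    rw [Finset.sum_add_distrib, Finset.sum_add_distrib, Finset.sum_add_distrib,
      show ∑ j, c1 i (j - 1) = ∑ j, c1 i j from
        (Equiv.subRight (1 : ZMod q)).sum_comp (fun j => c1 i j), add_assoc, two, add_zero] at h2
    have aux : ∀ a b : ZMod 2, a + b = 0 → a = b := by decide
    exact aux _ _ h2
  choose R hR0 hR using fun i => integ q (c0 i) (h0' i) j0
  obtain ⟨C, -, hC⟩ := integ p (fun i => c1 i j0) h1 i0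
  refine ⟨fun i j => C i + R i j, fun i j => ⟨?_, ?_⟩⟩
  · show C i + R i j = C i + R i (j - 1) + c0 i j
    rw [hR i j]; ring
  · have := const_of_step q (fun j => C i + R i j + (C (i - 1) + R (i - 1) j) + c1 i j) (by
      intro j
      have a1 := hR i j
      have a2 := hR (i - 1) j
      have a3 := hz i j
      rw [a1, a2]
      generalize R i (j - 1) = u at *
      generalize R (i - 1) (j - 1) = v at *
      generalize c0 i j = w at *
      generalize c0 (i - 1) j = z at *
      generalize c1 i j = y at *
      generalize c1 i (j - 1) = y' at *
      generalize C i = k at *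
      generalize C (i - 1) = k' at *
      clear * - a3
      have : y' = w + z + y := by revert w z y y'; decide
      subst this
      ring) j j0
    simp only [hR0, hC i] at this
    show C i + R i j = C (i - 1) + R (i - 1) j + c1 i j
    rw [hC i]
    generalize C (i - 1) = k at *
    generalize R i j = u at *
    generalize R (i - 1) j = v at *
    generalize c1 i j = w at *
    generalize c1 i j0 = w' at *
    clear * - this
    revert k u v w w'
    decide

theorem cd_rev1 (h : CC p q L x d) (y : G p q) (e : Fin 4) (hc : cd x d y e) :
    cd x d (y + dirv p q e) (e + 2) := by
  obtain ⟨t, ⟨rfl, rfl⟩ | ⟨rfl, rfl⟩⟩ := hc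
  · exact ⟨t, Or.inr ⟨(h.step t).symm, rfl⟩⟩
  · refine ⟨t, Or.inl ⟨?_, ?_⟩⟩
    · rw [vec2', h.step]; simp
    · generalize d t = z; revert z; decide

theorem cd_rev (h : CC p q L x d) (y : G p q) (e : Fin 4) :
    cd x d (y + dirv p q e) (e + 2) ↔ cd x d y e := by
  refine ⟨fun hc => ?_, cd_rev1 h y e⟩
  have := cd_rev1 h _ _ hc
  rw [vec2'] at this
  have e4 : e + 2 + 2 = e := by clear * -; revert e; decide
  simpa [e4] using this

open Classical in
theorem cd_sum (h : CC p q L x d) (y : G p q) :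
    ∑ e, (if cd x d y e then (1 : ZMod 2) else 0) = 0 := by
  by_cases hy : ∃ t, y = x (t + 1)
  · obtain ⟨t, rfl⟩ := hy
    have := h.turn t
    simp only [h.cd_iff]
    generalize d (t + 1) = u at *
    generalize d t + 2 = w at *
    clear * - this
    revert u w
    simp only [Fin.sum_univ_four]
    decide
  · apply Finset.sum_eq_zero
    intro e _
    rw [if_neg]
    rintro ⟨t, ⟨h1, -⟩ | ⟨h1, -⟩⟩
    · obtain ⟨t', ht'⟩ := h.on t
      exact hy ⟨t', h1.trans ht'⟩
    · exact hy ⟨t, h1⟩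

open Classical in
theorem exists_jump [NeZero p] [NeZero q] (h : CC p q L x d) (i0 : ZMod p) (j0 : ZMod q)
    (h0 : Even (Finset.univ.filter (fun j => cd x d (i0, j) 0)).card)
    (h1 : Even (Finset.univ.filter (fun i => cd x d (i, j0) 1)).card) :
    ∃ s : G p q → Bool, Jump s x d := by
  have r2 : ∀ i j, cd x d (i, j) 2 ↔ cd x d (i - 1, j) 0 := by
    intro i j
    have := cd_rev h (i - 1, j) 0
    simpa [dirv] using this
  have r3 : ∀ i j, cd x d (i, j) 3 ↔ cd x d (i, j - 1) 1 := by
    intro i j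
    have := cd_rev h (i, j - 1) 1
    simpa [dirv] using this
  obtain ⟨s, hs⟩ := poincare (fun i j => if cd x d (i, j) 0 then (1 : ZMod 2) else 0)
    (fun i j => if cd x d (i, j) 1 then (1 : ZMod 2) else 0)
    (by
      intro i j
      have := cd_sum h (i, j)
      rw [Fin.sum_univ_four] at this
      simp only [r2, r3] at this
      linear_combination this) i0 j0
    (by rw [Finset.sum_boole]; exact (ZMod.natCast_eq_zero_iff_even).2 h0)
    (by rw [Finset.sum_boole]; exact (ZMod.natCast_eq_zero_iff_even).2 h1)
  have hs0 : ∀ i j, s i j ≠ s i (j - 1) ↔ cd x d (i, j) 0 := by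
    intro i j
    rw [(hs i j).1]
    by_cases hc : cd x d (i, j) 0 <;> simp [hc]
  have hs1 : ∀ i j, s i j ≠ s (i - 1) j ↔ cd x d (i, j) 1 := by
    intro i j
    rw [(hs i j).2]
    by_cases hc : cd x d (i, j) 1 <;> simp [hc]
  have dec : ∀ a b : ZMod 2, decide (a = 1) ≠ decide (b = 1) ↔ a ≠ b := by decide
  refine ⟨fun y => decide (s y.1 y.2 = 1), ?_⟩
  rintro ⟨i, j⟩ e
  unfold inK
  rw [dec]
  fin_cases e
  · simpa [offF, show (-1 : Fin 4) = 3 from rfl, ← sub_eq_add_neg] using hs0 i j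
  · simpa [offF, ← sub_eq_add_neg, eq_comm] using hs1 i j
  · have := (hs0 (i - 1) j).trans (r2 i j).symm
    simpa [offF, ← sub_eq_add_neg, eq_comm] using this
  · have := (hs1 i (j - 1)).trans (r3 i j).symm
    simpa [offF, ← sub_eq_add_neg, eq_comm] using this

open Classical in
theorem coarse_main [NeZero p] [NeZero q] (h : CC p q L x d) (i0 : ZMod p) (j0 : ZMod q)
    (h0 : Even (Finset.univ.filter (fun j => cd x d (i0, j) 0)).card)
    (h1 : Even (Finset.univ.filter (fun i => cd x d (i, j0) 1)).card) :
    ∃ s : G p q → Bool, Jump s x d ∧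
      Odd ((Finset.univ.filter (fun x => Vin s x = true)).card
      + (Finset.univ.filter (fun x => E0in s x = true)).card
      + (Finset.univ.filter (fun x => E1in s x = true)).card
      + (Finset.univ.filter (fun x => s x = true)).card) := by
  obtain ⟨s, hs⟩ := exists_jump h i0 j0 h0 h1
  exact exists_odd h s hs
end coarse
end EE

namespace EE

section fine

/-- Doubling. -/
def dbl (p : ℕ) : ZMod p →+ ZMod (p + p) :=
  ZMod.lift p ⟨(zmultiplesHom (ZMod (p + p))) 2, by
    have : ((p + p : ℕ) : ZMod (p + p)) = 0 := ZMod.natCast_self _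
    simp only [zmultiplesHom_apply, natCast_zsmul, nsmul_eq_mul]
    rw [← this]; push_cast; ring⟩

theorem dbl_natCast (p k : ℕ) : dbl p (k : ZMod p) = 2 * (k : ZMod (p + p)) := by
  have := ZMod.lift_coe p (A := ZMod (p + p)) ⟨(zmultiplesHom (ZMod (p + p))) 2, by
    have : ((p + p : ℕ) : ZMod (p + p)) = 0 := ZMod.natCast_self _
    simp only [zmultiplesHom_apply, natCast_zsmul, nsmul_eq_mul]
    rw [← this]; push_cast; ring⟩ (k : ℤ)
  simp at this
  rw [mul_comm]
  simpa [dbl] using this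

theorem dbl_one (p : ℕ) : dbl p 1 = 2 := by
  have := dbl_natCast p 1
  simpa using this

def bit (p : ℕ) (b : Bool) : ZMod p := if b then 1 else 0

theorem dbl_surj (p : ℕ) [NeZero p] :
    Function.Surjective (fun y : ZMod p × Bool => dbl p y.1 + bit (p + p) y.2) := by
  intro z
  refine ⟨((z.val / 2 : ℕ), decide (z.val % 2 = 1)), ?_⟩
  have h := Nat.div_add_mod z.val 2
  have hz : ((z.val : ℕ) : ZMod (p + p)) = z := by simp
  simp only [dbl_natCast]
  conv_rhs => rw [← hz, ← h]
  push_cast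
  congr 1
  rcases Nat.mod_two_eq_zero_or_one z.val with h' | h' <;> simp [h', bit]

theorem dbl_bij (p : ℕ) [NeZero p] :
    Function.Bijective (fun y : ZMod p × Bool => dbl p y.1 + bit (p + p) y.2) := by
  rw [Fintype.bijective_iff_surjective_and_card]
  refine ⟨dbl_surj p, ?_⟩
  simp [ZMod.card]; ring

theorem dbl_inj {p : ℕ} [NeZero p] {a b : ZMod p} (h : dbl p a = dbl p b) : a = b := by
  have := (dbl_bij p).1 (a₁ := (a, false)) (a₂ := (b, false)) (by simp [h])
  simpa using this

theorem dbl_ne {p : ℕ} [NeZero p] (a b : ZMod p) : dbl p a + 1 ≠ dbl p b := by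
  intro h
  have := (dbl_bij p).1 (a₁ := (a, true)) (a₂ := (b, false)) (by simp [h, bit])
  simp at this

variable {p q : ℕ}

def Th (o : TorV (p + p) (q + q)) (y : G p q) (b b' : Bool) : TorV (p + p) (q + q) :=
  (o.1 + (dbl p y.1 + bit _ b), o.2 + (dbl q y.2 + bit _ b'))

def emb (o : TorV (p + p) (q + q)) (y : G p q) : TorV (p + p) (q + q) :=
  (o.1 + dbl p y.1, o.2 + dbl q y.2)

theorem emb_dirv (o : TorV (p + p) (q + q)) (y : G p q) (e : Fin 4) :
    emb o (y + dirv p q e) = emb o y + dirv _ _ e + dirv _ _ e := by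
  fin_cases e <;> ext <;> simp [emb, dirv, dbl_one] <;> ring

theorem emb_inj [NeZero p] [NeZero q] {o : TorV (p + p) (q + q)} {y z : G p q}
    (h : emb o y = emb o z) : y = z := by
  simp only [emb, Prod.mk.injEq, add_right_inj] at h
  exact Prod.ext (dbl_inj h.1) (dbl_inj h.2)

structure FD (p q L : ℕ) (g : ℕ → TorV (p + p) (q + q)) (x : ℕ → G p q) (d : ℕ → Fin 4) : Prop where
  cc : CC p q L x d
  ge : ∀ t, g (2 * t) = emb (g 0) (x t)
  go : ∀ t, g (2 * t + 1) = g (2 * t) + dirv _ _ (d t)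
  gs : ∀ t, g (2 * t + 2) = g (2 * t + 1) + dirv _ _ (d t)

variable {L : ℕ} {g : ℕ → TorV (p + p) (q + q)} {x : ℕ → G p q} {d : ℕ → Fin 4}

def EC (g : ℕ → TorV (p + p) (q + q)) (e : Sym2 (TorV (p + p) (q + q))) : Prop :=
  ∃ i, e = s(g i, g (i + 1))

theorem FD.edges (h : FD p q L g x d) (y : G p q) (e : Fin 4) (hc : cd x d y e) :
    EC g s(emb (g 0) y, emb (g 0) y + dirv _ _ e) ∧
    EC g s(emb (g 0) y + dirv _ _ e, emb (g 0) y + dirv _ _ e + dirv _ _ e) ∧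
    ∃ t, emb (g 0) y + dirv _ _ e = g (2 * t + 1) := by
  obtain ⟨t, ⟨rfl, rfl⟩ | ⟨rfl, rfl⟩⟩ := hc
  · rw [← h.ge, ← h.go, ← h.gs]
    exact ⟨⟨_, rfl⟩, ⟨_, rfl⟩, t, rfl⟩
  · have e1 : emb (g 0) (x (t + 1)) + dirv _ _ (d t + 2) = g (2 * t + 1) := by
      rw [← h.ge, mul_add, mul_one, h.gs, vec2']; simp
    have e2 : g (2 * t + 1) + dirv _ _ (d t + 2) = g (2 * t) := by
      rw [h.go, vec2']; simp
    rw [e1, e2, ← h.ge]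
    exact ⟨⟨2 * t + 1, Sym2.eq_swap⟩, ⟨2 * t, Sym2.eq_swap⟩, t, rfl⟩

theorem FD.mid0 [NeZero p] [NeZero q] (h : FD p q L g x d) (y : G p q) (t : ℕ)
    (ht : emb (g 0) y + (1, 0) = g (2 * t + 1)) : cd x d y 0 := by
  rw [h.go, h.ge] at ht
  have hst := h.cc.step t
  have hd : ∃ e, d t = e := ⟨_, rfl⟩
  obtain ⟨e, he⟩ := hd
  rw [he] at ht hst
  simp only [emb, Prod.ext_iff, Prod.fst_add, Prod.snd_add] at ht
  obtain ⟨h1, h2⟩ := ht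
  fin_cases e
  · refine ⟨t, Or.inl ⟨Prod.ext (dbl_inj ?_) (dbl_inj ?_), he.symm⟩⟩
    · simpa [dirv] using h1
    · simpa [dirv] using h2
  · exfalso
    simp [dirv, add_assoc] at h1
    exact dbl_ne _ _ h1
  · refine ⟨t, Or.inr ⟨?_, by rw [he]; decide⟩⟩
    rw [hst]
    refine Prod.ext (dbl_inj ?_) (dbl_inj ?_)
    · simp [dirv, dbl_one] at h1 ⊢
      linear_combination h1
    · simpa [dirv] using h2
  · exfalso
    simp [dirv, add_assoc] at h1
    exact dbl_ne _ _ h1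

theorem FD.mid1 [NeZero p] [NeZero q] (h : FD p q L g x d) (y : G p q) (t : ℕ)
    (ht : emb (g 0) y + (0, 1) = g (2 * t + 1)) : cd x d y 1 := by
  rw [h.go, h.ge] at ht
  have hst := h.cc.step t
  have hd : ∃ e, d t = e := ⟨_, rfl⟩
  obtain ⟨e, he⟩ := hd
  rw [he] at ht hst
  simp only [emb, Prod.ext_iff, Prod.fst_add, Prod.snd_add] at ht
  obtain ⟨h1, h2⟩ := ht
  fin_cases e
  · exfalso
    simp [dirv, add_assoc] at h2
    exact dbl_ne _ _ h2
  · refine ⟨t, Or.inl ⟨Prod.ext (dbl_inj ?_) (dbl_inj ?_), he.symm⟩⟩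
    · simpa [dirv] using h1
    · simpa [dirv] using h2
  · exfalso
    simp [dirv, add_assoc] at h2
    exact dbl_ne _ _ h2
  · refine ⟨t, Or.inr ⟨?_, by rw [he]; decide⟩⟩
    rw [hst]
    refine Prod.ext (dbl_inj ?_) (dbl_inj ?_)
    · simpa [dirv] using h1
    · simp [dirv, dbl_one] at h2 ⊢
      linear_combination h2

theorem row_exists (p : ℕ) [NeZero p] (r : ZMod (p + p)) :
    ∃ i0 : ZMod p, r + dbl p i0 + 1 = 0 ∨ r + dbl p i0 + 1 = -1 := by
  obtain ⟨⟨i, b⟩, h⟩ := dbl_surj p (-r)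
  cases b
  · refine ⟨i - 1, Or.inr ?_⟩
    simp [bit] at h
    rw [map_sub, h, dbl_one]; ring
  · refine ⟨i, Or.inl ?_⟩
    simp [bit] at h
    linear_combination h

theorem EC.split {g : ℕ → TorV (p + p) (q + q)} {a b : TorV (p + p) (q + q)} (h : EC g s(a, b)) :
    (∃ t t', a = g (2 * t) ∧ b = g (2 * t' + 1)) ∨ (∃ t t', b = g (2 * t) ∧ a = g (2 * t' + 1)) := by
  obtain ⟨i, hi⟩ := h
  rw [Sym2.eq_iff] at hi
  obtain ⟨t, rfl | rfl⟩ := Nat.even_or_odd' i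
  · rcases hi with ⟨h1, h2⟩ | ⟨h1, h2⟩
    · exact Or.inl ⟨t, t, h1, h2⟩
    · exact Or.inr ⟨t, t, h2, h1⟩
  · rcases hi with ⟨h1, h2⟩ | ⟨h1, h2⟩
    · exact Or.inr ⟨t + 1, t, h2, h1⟩
    · exact Or.inl ⟨t + 1, t, h1, h2⟩

theorem FD.rowEdge [NeZero p] [NeZero q] (h : FD p q L g x d) {i0 : ZMod p}
    {μ μ' : ZMod (p + p)} (hμ : (g 0).1 + dbl p i0 + 1 = μ) (hμ' : μ' = μ + 1 ∨ μ' = μ - 1)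
    (j' : ZMod (q + q)) :
    EC g s((μ, j'), (μ', j')) ↔ ∃ j, j' = (g 0).2 + dbl q j ∧ cd x d (i0, j) 0 := by
  constructor
  · intro he
    rcases he.split with ⟨t, t', h1, h2⟩ | ⟨t, t', h1, h2⟩
    · exfalso
      rw [h.ge] at h1
      have := congrArg Prod.fst h1
      simp only [emb] at this
      rw [← hμ, add_assoc] at this
      exact dbl_ne _ _ (add_left_cancel this)
    · rw [h.ge] at h1
      have := congrArg Prod.snd h1
      simp only [emb] at this
      refine ⟨(x t).2, this, h.mid0 _ t' ?_⟩
      rw [← h2, this, ← hμ]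
      simp [emb]
  · rintro ⟨j, rfl, hc⟩
    obtain ⟨h1, h2, -⟩ := h.edges _ _ hc
    rcases hμ' with rfl | rfl
    · convert h2 using 2 <;> simp [emb, dirv, ← hμ]
    · rw [Sym2.eq_swap]
      convert h1 using 2 <;> simp [emb, dirv, ← hμ]

theorem FD.colEdge [NeZero p] [NeZero q] (h : FD p q L g x d) {j0 : ZMod q}
    {μ μ' : ZMod (q + q)} (hμ : (g 0).2 + dbl q j0 + 1 = μ) (hμ' : μ' = μ + 1 ∨ μ' = μ - 1)
    (i' : ZMod (p + p)) :
    EC g s((i', μ), (i', μ')) ↔ ∃ i, i' = (g 0).1 + dbl p i ∧ cd x d (i, j0) 1 := by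
  constructor
  · intro he
    rcases he.split with ⟨t, t', h1, h2⟩ | ⟨t, t', h1, h2⟩
    · exfalso
      rw [h.ge] at h1
      have := congrArg Prod.snd h1
      simp only [emb] at this
      rw [← hμ, add_assoc] at this
      exact dbl_ne _ _ (add_left_cancel this)
    · rw [h.ge] at h1
      have := congrArg Prod.fst h1
      simp only [emb] at this
      refine ⟨(x t).1, this, h.mid1 _ t' ?_⟩
      rw [← h2, this, ← hμ]
      simp [emb]
  · rintro ⟨j, rfl, hc⟩
    obtain ⟨h1, h2, -⟩ := h.edges _ _ hc
    rcases hμ' with rfl | rfl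
    · convert h2 using 2 <;> simp [emb, dirv, ← hμ]
    · rw [Sym2.eq_swap]
      convert h1 using 2 <;> simp [emb, dirv, ← hμ]

open Classical in
theorem FD.cardA [NeZero p] [NeZero q] [NeZero (q + q)] (h : FD p q L g x d) (C : Finset (Sym2 (TorV (p + p) (q + q))))
    (hC : ∀ e, e ∈ C ↔ EC g e) :
    ∃ i0 : ZMod p, (Finset.univ.filter (fun j => cd x d (i0, j) 0)).card =
      (C ∩ layerA (p + p) (q + q)).card := by
  obtain ⟨i0, hi0⟩ := row_exists p (g 0).1
  have key : ∀ j', EC g s(((0 : ZMod (p + p)), j'), ((-1 : ZMod (p + p)), j')) ↔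
      ∃ j, j' = (g 0).2 + dbl q j ∧ cd x d (i0, j) 0 := by
    intro j'
    rcases hi0 with h0 | h0
    · exact h.rowEdge h0 (Or.inr (by simp)) j'
    · rw [Sym2.eq_swap]
      exact h.rowEdge h0 (Or.inl (by simp)) j'
  refine ⟨i0, Finset.card_bij
    (fun j _ => s(((0 : ZMod (p + p)), (g 0).2 + dbl q j), ((-1 : ZMod (p + p)), (g 0).2 + dbl q j))) ?_ ?_ ?_⟩
  · intro j hj
    rw [Finset.mem_inter, hC, key]
    refine ⟨⟨j, rfl, by simpa using hj⟩, ?_⟩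
    simp only [layerA, Finset.mem_image]
    exact ⟨_, Finset.mem_univ _, rfl⟩
  · intro a _ b _ hab
    rw [Sym2.eq_iff] at hab
    rcases hab with ⟨h1, -⟩ | ⟨h1, -⟩
    · exact dbl_inj (add_left_cancel (congrArg Prod.snd h1))
    · exact dbl_inj (add_left_cancel (congrArg Prod.snd h1))
  · intro e he
    rw [Finset.mem_inter, hC] at he
    obtain ⟨h1, h2⟩ := he
    simp only [layerA, Finset.mem_image] at h2
    obtain ⟨j', -, rfl⟩ := h2
    obtain ⟨j, rfl, hj⟩ := (key j').1 h1
    exact ⟨j, by simpa using hj, rfl⟩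

open Classical in
theorem FD.cardB [NeZero p] [NeZero q] [NeZero (p + p)] (h : FD p q L g x d) (C : Finset (Sym2 (TorV (p + p) (q + q))))
    (hC : ∀ e, e ∈ C ↔ EC g e) :
    ∃ j0 : ZMod q, (Finset.univ.filter (fun i => cd x d (i, j0) 1)).card =
      (C ∩ layerB (p + p) (q + q)).card := by
  obtain ⟨j0, hj0⟩ := row_exists q (g 0).2
  have key : ∀ i', EC g s((i', (0 : ZMod (q + q))), (i', (-1 : ZMod (q + q)))) ↔
      ∃ i, i' = (g 0).1 + dbl p i ∧ cd x d (i, j0) 1 := by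
    intro i'
    rcases hj0 with h0 | h0
    · exact h.colEdge h0 (Or.inr (by simp)) i'
    · rw [Sym2.eq_swap]
      exact h.colEdge h0 (Or.inl (by simp)) i'
  refine ⟨j0, Finset.card_bij
    (fun i _ => s(((g 0).1 + dbl p i, (0 : ZMod (q + q))), ((g 0).1 + dbl p i, (-1 : ZMod (q + q))))) ?_ ?_ ?_⟩
  · intro j hj
    rw [Finset.mem_inter, hC, key]
    refine ⟨⟨j, rfl, by simpa using hj⟩, ?_⟩
    simp only [layerB, Finset.mem_image]
    exact ⟨_, Finset.mem_univ _, rfl⟩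
  · intro a _ b _ hab
    rw [Sym2.eq_iff] at hab
    rcases hab with ⟨h1, -⟩ | ⟨h1, -⟩
    · exact dbl_inj (add_left_cancel (congrArg Prod.fst h1))
    · exact dbl_inj (add_left_cancel (congrArg Prod.fst h1))
  · intro e he
    rw [Finset.mem_inter, hC] at he
    obtain ⟨h1, h2⟩ := he
    simp only [layerB, Finset.mem_image] at h2
    obtain ⟨j', -, rfl⟩ := h2
    obtain ⟨j, rfl, hj⟩ := (key j').1 h1
    exact ⟨j, by simpa using hj, rfl⟩

end fine
end EE

namespace EE
section fine2
variable {p q : ℕ}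

theorem adj_dir {m n : ℕ} {a b : TorV m n} (h : torAdj m n a b) : ∃ e, b = a + dirv m n e := by
  obtain ⟨a1, a2⟩ := a
  obtain ⟨b1, b2⟩ := b
  simp only [torAdj] at h
  rcases h with ⟨rfl, rfl | rfl⟩ | ⟨rfl, rfl | rfl⟩
  · exact ⟨3, by simp [dirv]⟩
  · exact ⟨1, by simp [dirv]⟩
  · exact ⟨2, by simp [dirv]⟩
  · exact ⟨0, by simp [dirv]⟩

/-- Parity homomorphism. -/
def par (p : ℕ) : ZMod (p + p) →+* ZMod 2 := ZMod.castHom (⟨p, by ring⟩ : 2 ∣ p + p) (ZMod 2)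

theorem black_iff [NeZero p] [NeZero q] (v : TorV (p + p) (q + q)) :
    IsBlack v ↔ par p v.1 + par q v.2 = 0 := by
  have h1 : par p v.1 = (v.1.val : ZMod 2) := by
    conv_lhs => rw [← ZMod.natCast_zmod_val v.1]
    exact map_natCast _ _
  have h2 : par q v.2 = (v.2.val : ZMod 2) := by
    conv_lhs => rw [← ZMod.natCast_zmod_val v.2]
    exact map_natCast _ _
  rw [h1, h2, IsBlack, ← ZMod.natCast_eq_zero_iff_even]
  push_cast; rfl

theorem black_flip [NeZero p] [NeZero q] {a b : TorV (p + p) (q + q)}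
    (h : torAdj _ _ a b) : IsBlack b ↔ ¬ IsBlack a := by
  obtain ⟨e, rfl⟩ := adj_dir h
  rw [black_iff, black_iff]
  have : ∀ u v : ZMod 2, (u + 1 + v = 0 ↔ ¬ u + v = 0) ∧ (u + (v + 1) = 0 ↔ ¬ u + v = 0) ∧
    (u + -1 + v = 0 ↔ ¬ u + v = 0) ∧ (u + (v + -1) = 0 ↔ ¬ u + v = 0) := by decide
  have := this (par p a.1) (par q a.2)
  fin_cases e <;> simp only [dirv, Prod.fst_add, Prod.snd_add, map_add, map_one, map_zero, map_neg, add_zero]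
  · exact this.1
  · exact this.2.1
  · exact this.2.2.1
  · exact this.2.2.2

theorem one_ne (p : ℕ) [NeZero p] : (1 : ZMod (p + p)) ≠ 0 := by
  intro h
  have := congrArg (par p) h
  simp at this

theorem pm_unique {m n : ℕ} {M : Finset (Sym2 (TorV m n))} (hM : IsPM m n M) {v a b : TorV m n}
    (ha : s(v, a) ∈ M) (hb : s(v, b) ∈ M) : a = b := by
  have := (hM.2 v).unique ⟨ha, by simp⟩ ⟨hb, by simp⟩
  exact Sym2.congr_right.1 this

theorem straight [NeZero p] [NeZero q] {M : Finset (Sym2 (TorV (p + p) (q + q)))}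
    (hM : IsPM _ _ M) {a b c : TorV (p + p) (q + q)} (ha : IsBlack a)
    (hab : dArc _ _ M a b) (hbc : dArc _ _ M b c) :
    s(a, b) ∈ M ∧ s(b, c) ∉ M ∧ ∃ e, b = a + dirv _ _ e ∧ c = b + dirv _ _ e := by
  have h1 : torAdj _ _ a b ∧ s(a, b) ∈ M := by
    rcases hab with h | h
    · exact h.2
    · exact absurd ha h.1
  have hb : ¬ IsBlack b := by
    rw [black_flip h1.1]; exact not_not.2 ha
  have h2 : torAdj _ _ b c ∧ s(b, c) ∉ M ∧ ∃ u, s(u, b) ∈ M ∧ Collin u b c := by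
    rcases hbc with h | h
    · exact absurd h.1 hb
    · exact h.2
  obtain ⟨hadj, hn, u, hu, hcol⟩ := h2
  have hua : u = a := pm_unique hM (v := b) (by rwa [Sym2.eq_swap]) (by rw [Sym2.eq_swap]; exact h1.2)
  subst hua
  refine ⟨h1.2, hn, ?_⟩
  obtain ⟨e, rfl⟩ := adj_dir h1.1
  obtain ⟨e', rfl⟩ := adj_dir hadj
  have hne : e' ≠ e + 2 := by
    rintro rfl
    rw [vec2', add_neg_cancel_right, Sym2.eq_swap] at hn
    exact hn h1.2
  have o1 := one_ne p
  have o2 := one_ne q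
  refine ⟨e, rfl, ?_⟩
  suffices e' = e by rw [this]
  simp only [Collin, Prod.fst_add, Prod.snd_add] at hcol
  clear * - hcol hne o1 o2
  fin_cases e <;> fin_cases e' <;> simp [dirv, o1, o2] at hcol hne ⊢ 

theorem exists_FD [NeZero p] [NeZero q] {M : Finset (Sym2 (TorV (p + p) (q + q)))}
    (hM : IsPM _ _ M) {k : ℕ} {g : ℕ → TorV (p + p) (q + q)} (hc : IsDiCycle _ _ M k g)
    (hb : IsBlack (g 0)) :
    (∃ L x d, FD p q L g x d) ∧ ∀ t, s(g (2 * t), g (2 * t + 1)) ∈ M := by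
  obtain ⟨hk, hinj, hper, harc⟩ := hc
  have hadj : ∀ i, torAdj _ _ (g i) (g (i + 1)) := by
    intro i
    rcases harc i with h | h
    · exact h.2.1
    · exact h.2.1
  have hcol : ∀ i, IsBlack (g i) ↔ Even i := by
    intro i
    induction i with
    | zero => simp [hb]
    | succ i ih => rw [black_flip (hadj i), ih, Nat.even_add_one]
  have hke : Even k := by
    rw [← hcol]
    have := hper 0
    rw [zero_add] at this
    rwa [this]
  obtain ⟨L, rfl⟩ := hke.two_dvd
  have hLpos : 0 < L := by omega
  have hmod : ∀ a b, g a = g b → a ≡ b [MOD 2 * L] := by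
    intro a b hab
    have hp : Function.Periodic g (2 * L) := hper
    rw [← hp.map_mod_nat a, ← hp.map_mod_nat b] at hab
    exact hinj _ (Nat.mod_lt _ hk) _ (Nat.mod_lt _ hk) hab
  have hst : ∀ t, s(g (2 * t), g (2 * t + 1)) ∈ M ∧ s(g (2 * t + 1), g (2 * t + 2)) ∉ M ∧
      ∃ e, g (2 * t + 1) = g (2 * t) + dirv _ _ e ∧ g (2 * t + 2) = g (2 * t + 1) + dirv _ _ e :=
    fun t => straight hM ((hcol _).2 (by simp)) (harc _) (harc _)
  refine ⟨?_, fun t => (hst t).1⟩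
  choose hs1 hs2 d0 hd1 hd2 using hst
  have hgL : ∀ r t, g (2 * (t % L) + r) = g (2 * t + r) := by
    intro r t
    refine per_mod hper (Nat.ModEq.add_right r ?_)
    exact Nat.ModEq.mul_left' 2 (Nat.mod_modEq t L)
  let d : ℕ → Fin 4 := fun t => d0 (t % L)
  have go : ∀ t, g (2 * t + 1) = g (2 * t) + dirv _ _ (d t) := by
    intro t
    have := hd1 (t % L)
    rw [hgL 1] at this
    have e := hgL 0 t
    rw [add_zero, add_zero] at e
    rwa [e] at this
  have gs : ∀ t, g (2 * t + 2) = g (2 * t + 1) + dirv _ _ (d t) := by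
    intro t
    have := hd2 (t % L)
    rwa [hgL 1, hgL 2] at this
  let x : ℕ → G p q := fun t => ∑ i ∈ Finset.range t, dirv p q (d i)
  have hx : ∀ t, x (t + 1) = x t + dirv p q (d t) := fun t => Finset.sum_range_succ _ _
  have ge : ∀ t, g (2 * t) = emb (g 0) (x t) := by
    intro t
    induction t with
    | zero => simp [x, emb]
    | succ t ih => rw [mul_add, mul_one, gs, go, hx, emb_dirv, ih]
  refine ⟨L, x, d, ⟨hLpos, ?_, ?_, ?_, hx, ?_⟩, ge, go, gs⟩
  · intro t
    apply emb_inj (o := g 0)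
    rw [← ge, ← ge, mul_add, hper]
  · intro t; simp [d]
  · intro a b hab
    have : g (2 * a) = g (2 * b) := by rw [ge, ge, hab]
    exact Nat.ModEq.mul_left_cancel' (by norm_num) (hmod _ _ this)
  · intro t ht
    have h1 := go (t + 1)
    have e1 : 2 * (t + 1) = 2 * t + 2 := by ring
    rw [ht, vec2', e1, gs t, add_neg_cancel_right] at h1
    have h2 := hs1 (t + 1)
    rw [e1, h1, Sym2.eq_swap] at h2
    exact hs2 t h2

/-- Interior indicator on fine cells. -/
def wf (s : G p q → Bool) (z : G p q × Bool × Bool) : Bool :=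
  match z with
  | (y, false, false) => Vin s y
  | (y, true, false) => E0in s y
  | (y, false, true) => E1in s y
  | (y, true, true) => s y

theorem Th_bij [NeZero p] [NeZero q] (o : TorV (p + p) (q + q)) :
    Function.Bijective (fun z : G p q × Bool × Bool => Th o z.1 z.2.1 z.2.2) := by
  constructor
  · rintro ⟨⟨i, j⟩, b, b'⟩ ⟨⟨i', j'⟩, c, c'⟩ h
    simp only [Th, Prod.mk.injEq, add_right_inj] at h
    have h1 := (dbl_bij p).1 (a₁ := (i, b)) (a₂ := (i', c)) h.1
    have h2 := (dbl_bij q).1 (a₁ := (j, b')) (a₂ := (j', c')) h.2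
    simp only [Prod.mk.injEq] at h1 h2 ⊢
    tauto
  · rintro ⟨u, v⟩
    obtain ⟨⟨i, b⟩, h1⟩ := dbl_surj p (u - o.1)
    obtain ⟨⟨j, b'⟩, h2⟩ := dbl_surj q (v - o.2)
    refine ⟨((i, j), b, b'), ?_⟩
    simp only at h1 h2
    simp [Th, h1, h2]

noncomputable def ThE [NeZero p] [NeZero q] (o : TorV (p + p) (q + q)) :
    (G p q × Bool × Bool) ≃ TorV (p + p) (q + q) := Equiv.ofBijective _ (Th_bij o)

theorem card_wf [NeZero p] [NeZero q] (s : G p q → Bool) :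
    (Finset.univ.filter (fun z => wf s z = true)).card =
      (Finset.univ.filter (fun x => Vin s x = true)).card
      + (Finset.univ.filter (fun x => E0in s x = true)).card
      + (Finset.univ.filter (fun x => E1in s x = true)).card
      + (Finset.univ.filter (fun x => s x = true)).card := by
  simp only [Finset.card_filter]
  rw [Fintype.sum_prod_type]
  simp only [Fintype.sum_prod_type (α₁ := Bool), Fintype.sum_bool, wf, Finset.sum_add_distrib]
  have H : ∀ a b c d a' b' c' d' : ℕ, a = a' → b = b' → c = c' → d = d' →
      a + b + (c + d) = d' + c' + b' + a' := by
    intros; omega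
  apply H <;> congr!

variable {L : ℕ} {g : ℕ → TorV (p + p) (q + q)} {x : ℕ → G p q} {d : ℕ → Fin 4}

theorem jump_all {s : G p q → Bool} (hJ : Jump s x d) (y : G p q) (h : ∀ e, ¬ cd x d y e) :
    s (y + (-1, 0)) = s y ∧ s (y + (-1, -1)) = s y ∧ s (y + (0, -1)) = s y := by
  have h' : ∀ e, inK s y e = inK s y (e - 1) := fun e => by
    by_contra hh; exact h e ((hJ y e).1 hh)
  have h1 := h' 1
  have h2 := h' 2
  have h3 := h' 3
  simp [inK, offF] at h1 h2 h3
  refine ⟨h1, h2.trans h1, h3.trans (h2.trans h1)⟩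

theorem Vin_of_all {s : G p q → Bool} (hJ : Jump s x d) (y : G p q) (h : ∀ e, ¬ cd x d y e) :
    Vin s y = s y ∧ E0in s y = s y ∧ E1in s y = s y ∧ E0in s (y + (-1, 0)) = s y ∧
      E1in s (y + (0, -1)) = s y := by
  obtain ⟨h1, h2, h3⟩ := jump_all hJ y h
  simp [Vin, E0in, E1in, h1, h2, h3, add_assoc]

theorem E0_jump {s : G p q → Bool} (hJ : Jump s x d) (y : G p q) :
    s y ≠ s (y + (0, -1)) ↔ cd x d y 0 := by
  have := hJ y 0
  simpa [inK, offF, show (-1 : Fin 4) = 3 from rfl] using this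

theorem E1_jump {s : G p q → Bool} (hJ : Jump s x d) (y : G p q) :
    s y ≠ s (y + (-1, 0)) ↔ cd x d y 1 := by
  have := hJ y 1
  simpa [inK, offF, eq_comm] using this

theorem FD.not_cd [NeZero p] [NeZero q] (h : FD p q L g x d) (y : G p q)
    (hy : ∀ i, Th (g 0) y false false ≠ g i) : ∀ e, ¬ cd x d y e := by
  have e0 : Th (g 0) y false false = emb (g 0) y := by simp [Th, emb, bit]
  rw [e0] at hy
  rintro e ⟨t, ⟨rfl, -⟩ | ⟨rfl, -⟩⟩
  · exact hy _ (h.ge t).symm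
  · exact hy _ (h.ge (t + 1)).symm

theorem FD.not_cd0 [NeZero p] [NeZero q] (h : FD p q L g x d) (y : G p q)
    (hy : ∀ i, Th (g 0) y true false ≠ g i) : ¬ cd x d y 0 := by
  intro hc
  obtain ⟨-, -, t, ht⟩ := h.edges _ _ hc
  apply hy (2 * t + 1)
  rw [← ht]; simp [Th, emb, bit, dirv, add_assoc]

theorem FD.not_cd1 [NeZero p] [NeZero q] (h : FD p q L g x d) (y : G p q)
    (hy : ∀ i, Th (g 0) y false true ≠ g i) : ¬ cd x d y 1 := by
  intro hc
  obtain ⟨-, -, t, ht⟩ := h.edges _ _ hc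
  apply hy (2 * t + 1)
  rw [← ht]; simp [Th, emb, bit, dirv, add_assoc]

/-- the fine interior indicator -/
noncomputable def wv [NeZero p] [NeZero q] (s : G p q → Bool) (o v : TorV (p + p) (q + q)) : Bool :=
  wf s ((ThE o).symm v)

theorem wv_Th [NeZero p] [NeZero q] (s : G p q → Bool) (o : TorV (p + p) (q + q)) (y : G p q)
    (b b' : Bool) : wv s o (Th o y b b') = wf s (y, b, b') := by
  unfold wv
  congr 1
  rw [Equiv.symm_apply_eq]; rfl

theorem Th_cases [NeZero p] [NeZero q] (o v : TorV (p + p) (q + q)) :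
    ∃ y b b', v = Th o y b b' := by
  obtain ⟨⟨y, b, b'⟩, h⟩ := (Th_bij o).2 v
  exact ⟨y, b, b', h.symm⟩

theorem Th_s0 (o : TorV (p + p) (q + q)) (y : G p q) (b' : Bool) :
    Th o y false b' + (1, 0) = Th o y true b' := by simp [Th, bit, add_assoc]
theorem Th_s1 (o : TorV (p + p) (q + q)) (y : G p q) (b' : Bool) :
    Th o y true b' + (1, 0) = Th o (y + (1, 0)) false b' := by
  ext <;> simp [Th, bit, dbl_one]; ring
theorem Th_t0 (o : TorV (p + p) (q + q)) (y : G p q) (b : Bool) :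
    Th o y b false + (0, 1) = Th o y b true := by simp [Th, bit, add_assoc]
theorem Th_t1 (o : TorV (p + p) (q + q)) (y : G p q) (b : Bool) :
    Th o y b true + (0, 1) = Th o (y + (0, 1)) b false := by
  ext <;> simp [Th, bit, dbl_one]; ring

theorem FD.adj0 [NeZero p] [NeZero q] (h : FD p q L g x d) {s : G p q → Bool} (hJ : Jump s x d)
    (v : TorV (p + p) (q + q)) (hv : ∀ i, v ≠ g i) (hv' : ∀ i, v + (1, 0) ≠ g i) :
    wv s (g 0) v = wv s (g 0) (v + (1, 0)) := by
  obtain ⟨y, b, b', rfl⟩ := Th_cases (g 0) v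
  cases b
  · rw [Th_s0] at hv' ⊢
    rw [wv_Th, wv_Th]
    cases b'
    · have := Vin_of_all hJ y (h.not_cd y hv)
      simp only [wf]; rw [this.1, this.2.1]
    · have := (E1_jump hJ y).not.2 (h.not_cd1 y hv)
      rw [not_not] at this
      simp [wf, E1in, ← this]
  · rw [Th_s1] at hv' ⊢
    rw [wv_Th, wv_Th]
    cases b'
    · have := Vin_of_all hJ _ (h.not_cd _ hv')
      simp only [wf]; rw [this.1, ← this.2.2.2.1]; simp [add_assoc, Prod.mk_zero_zero]
    · have := (E1_jump hJ _).not.2 (h.not_cd1 _ hv')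
      rw [not_not] at this
      simp only [wf, E1in]
      rw [this]; simp [add_assoc, Prod.mk_zero_zero]

theorem FD.adj1 [NeZero p] [NeZero q] (h : FD p q L g x d) {s : G p q → Bool} (hJ : Jump s x d)
    (v : TorV (p + p) (q + q)) (hv : ∀ i, v ≠ g i) (hv' : ∀ i, v + (0, 1) ≠ g i) :
    wv s (g 0) v = wv s (g 0) (v + (0, 1)) := by
  obtain ⟨y, b, b', rfl⟩ := Th_cases (g 0) v
  cases b'
  · rw [Th_t0] at hv' ⊢
    rw [wv_Th, wv_Th]
    cases b
    · have := Vin_of_all hJ y (h.not_cd y hv)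
      simp only [wf]; rw [this.1, this.2.2.1]
    · have := (E0_jump hJ y).not.2 (h.not_cd0 y hv)
      rw [not_not] at this
      simp [wf, E0in, ← this]
  · rw [Th_t1] at hv' ⊢
    rw [wv_Th, wv_Th]
    cases b
    · have := Vin_of_all hJ _ (h.not_cd _ hv')
      simp only [wf]; rw [this.1, ← this.2.2.2.2]; simp [add_assoc, Prod.mk_zero_zero]
    · have := (E0_jump hJ _).not.2 (h.not_cd0 _ hv')
      rw [not_not] at this
      simp only [wf, E0in]
      rw [this]; simp [add_assoc, Prod.mk_zero_zero]

theorem FD.adj [NeZero p] [NeZero q] (h : FD p q L g x d) {s : G p q → Bool} (hJ : Jump s x d)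
    {v v' : TorV (p + p) (q + q)} (hv : ∀ i, v ≠ g i) (hv' : ∀ i, v' ≠ g i)
    (ha : torAdj _ _ v v') : wv s (g 0) v = wv s (g 0) v' := by
  obtain ⟨e, he⟩ := adj_dir ha
  fin_cases e
  · have he : v' = v + (1, 0) := he
    subst he; exact h.adj0 hJ v hv hv'
  · have he : v' = v + (0, 1) := he
    subst he; exact h.adj1 hJ v hv hv'
  · have he : v = v' + (1, 0) := by rw [he]; ext <;> simp [dirv]
    subst he; exact (h.adj0 hJ v' hv' hv).symm
  · have he : v = v' + (0, 1) := by rw [he]; ext <;> simp [dirv]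
    subst he; exact (h.adj1 hJ v' hv' hv).symm

theorem FD.wv_cycle [NeZero p] [NeZero q] (h : FD p q L g x d) {s : G p q → Bool} (hJ : Jump s x d)
    (i : ℕ) : wv s (g 0) (g i) = false := by
  obtain ⟨t, rfl | rfl⟩ := Nat.even_or_odd' i
  · have e : g (2 * t) = Th (g 0) (x t) false false := by rw [h.ge]; simp [emb, Th, bit]
    rw [e, wv_Th]
    simp only [wf]
    by_contra hh
    have hh := (Vin_iff _ _).1 (by simpa using hh)
    have := (hJ (x t) (d t)).2 ⟨t, Or.inl ⟨rfl, rfl⟩⟩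
    rw [hh, hh] at this
    exact this rfl
  · obtain ⟨y, b, b', hy⟩ := Th_cases (g 0) (g (2 * t + 1))
    have ho := h.go t
    rw [h.ge] at ho
    have c0 : ∀ y, cd x d y 0 → E0in s y = false := by
      intro y hc
      have := (E0_jump hJ y).2 hc
      unfold E0in
      revert this
      cases s y <;> cases s (y + (0, -1)) <;> simp
    have c1 : ∀ y, cd x d y 1 → E1in s y = false := by
      intro y hc
      have := (E1_jump hJ y).2 hc
      unfold E1in
      revert this
      cases s y <;> cases s (y + (-1, 0)) <;> simp
    have hd : ∃ e, d t = e := ⟨_, rfl⟩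
    obtain ⟨e, he⟩ := hd
    rw [he] at ho
    have m0 : ∀ y, g (2 * t + 1) = Th (g 0) y true false → wv s (g 0) (g (2 * t + 1)) = false := by
      intro y hy
      rw [hy, wv_Th]
      exact c0 y (h.mid0 y t (by rw [hy]; simp [emb, Th, bit, add_assoc]))
    have m1 : ∀ y, g (2 * t + 1) = Th (g 0) y false true → wv s (g 0) (g (2 * t + 1)) = false := by
      intro y hy
      rw [hy, wv_Th]
      exact c1 y (h.mid1 y t (by rw [hy]; simp [emb, Th, bit, add_assoc]))
    fin_cases e
    · apply m0 (x t); rw [ho]; simp [emb, Th, bit, dirv, add_assoc]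
    · apply m1 (x t); rw [ho]; simp [emb, Th, bit, dirv, add_assoc]
    · apply m0 (x t - (1, 0)); rw [ho]; ext <;> simp [emb, Th, bit, dirv, dbl_one]; ring
    · apply m1 (x t - (0, 1)); rw [ho]; ext <;> simp [emb, Th, bit, dirv, dbl_one]; ring

theorem not_adj_self [NeZero p] [NeZero q] (v : TorV (p + p) (q + q)) : ¬ torAdj _ _ v v := by
  have o1 := one_ne p
  have o2 := one_ne q
  simp [torAdj, o1, o2]

theorem main_black [NeZero p] [NeZero q] [NeZero (p + p)] [NeZero (q + q)]
    {M : Finset (Sym2 (TorV (p + p) (q + q)))}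
    (hM : IsPM _ _ M) {k : ℕ} {g : ℕ → TorV (p + p) (q + q)} (hc : IsDiCycle _ _ M k g)
    (hb : IsBlack (g 0)) (C : Finset (Sym2 (TorV (p + p) (q + q)))) (hC : ∀ e, e ∈ C ↔ EC g e)
    (hA : Even (C ∩ layerA (p + p) (q + q)).card) (hB : Even (C ∩ layerB (p + p) (q + q)).card) :
    False := by
  obtain ⟨⟨L, x, d, h⟩, hm⟩ := exists_FD hM hc hb
  obtain ⟨i0, hi0⟩ := h.cardA C hC
  obtain ⟨j0, hj0⟩ := h.cardB C hC
  obtain ⟨s, hJ, hodd⟩ := coarse_main h.cc i0 j0 (by convert hA) (by convert hB)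
  have hpart : ∀ v, ∃ v', s(v, v') ∈ M := by
    intro v
    obtain ⟨e, ⟨he, hv⟩, -⟩ := hM.2 v
    obtain ⟨v', rfl⟩ := Sym2.mem_iff_exists.1 hv
    exact ⟨v', he⟩
  choose π hπ using hpart
  have hadj : ∀ v, torAdj _ _ v (π v) := fun v => hM.1 _ (hπ v) _ _ rfl
  have hinv : ∀ v, π (π v) = v := fun v =>
    pm_unique hM (hπ (π v)) (by rw [Sym2.eq_swap]; exact hπ v)
  have hcyc : ∀ i, ∃ j, π (g i) = g j := by
    intro i
    obtain ⟨t, rfl | rfl⟩ := Nat.even_or_odd' i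
    · exact ⟨_, pm_unique hM (hπ _) (hm t)⟩
    · exact ⟨_, pm_unique hM (hπ _) (by rw [Sym2.eq_swap]; exact hm t)⟩
  have hW : ∀ v, wv s (g 0) v = true → wv s (g 0) (π v) = true := by
    intro v hv
    have n1 : ∀ i, v ≠ g i := by
      rintro i rfl
      rw [h.wv_cycle hJ] at hv; simp at hv
    have n2 : ∀ i, π v ≠ g i := by
      intro i hi
      obtain ⟨j, hj⟩ := hcyc i
      rw [← hi, hinv] at hj
      exact n1 j hj
    rw [← h.adj hJ n1 n2 (hadj v)]; exact hv
  have hcard : (Finset.univ.filter (fun v => wv s (g 0) v = true)).card =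
      (Finset.univ.filter (fun z => wf s z = true)).card := by
    refine Finset.card_equiv (ThE (g 0)).symm ?_
    intro v
    rw [Finset.mem_filter, Finset.mem_filter]; simp [wv]
  rw [← card_wf, ← hcard] at hodd
  have hsum : ∑ v ∈ Finset.univ.filter (fun v => wv s (g 0) v = true), (1 : ZMod 2) = 0 := by
    refine Finset.sum_involution (fun v _ => π v) ?_ ?_ ?_ ?_
    · intro v _; decide
    · intro v _ _ hh
      have := hadj v
      rw [hh] at this
      exact not_adj_self v this
    · intro v hv
      simp only [Finset.mem_filter, Finset.mem_univ, true_and] at hv ⊢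
      exact hW v hv
    · intro v _; exact hinv v
  rw [Finset.sum_const, nsmul_eq_mul, mul_one, ZMod.natCast_eq_zero_iff_even] at hsum
  exact (Nat.not_even_iff_odd.2 hodd) hsum

end fine2
end EE

theorem no_ee_dicycle (m n : ℕ) [NeZero m] [NeZero n]
    (hm : Even m) (hn : Even n)
    (M : Finset (Sym2 (TorV m n))) (hM : IsPM m n M)
    (k : ℕ) (f : ℕ → TorV m n) (hc : IsDiCycle m n M k f) :
    ¬ (Even ((cycEdges k f) ∩ layerA m n).card ∧
       Even ((cycEdges k f) ∩ layerB m n).card) := by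
  rintro ⟨hA, hB⟩
  obtain ⟨p, rfl⟩ := hm
  obtain ⟨q, rfl⟩ := hn
  have hp : NeZero p := ⟨by rintro rfl; exact NeZero.ne (0 + 0) rfl⟩
  have hq : NeZero q := ⟨by rintro rfl; exact NeZero.ne (0 + 0) rfl⟩
  have hC : ∀ e, e ∈ cycEdges k f ↔ EE.EC f e := by
    intro e
    simp only [cycEdges, Finset.mem_image, Finset.mem_range]
    constructor
    · rintro ⟨i, -, rfl⟩; exact ⟨i, rfl⟩
    · rintro ⟨i, rfl⟩
      refine ⟨i % k, Nat.mod_lt _ hc.1, ?_⟩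
      rw [EE.per_mod hc.2.2.1 (Nat.mod_modEq i k),
        EE.per_mod hc.2.2.1 ((Nat.mod_modEq i k).add_right 1)]
  by_cases hb : IsBlack (f 0)
  · exact EE.main_black hM hc hb _ hC hA hB
  · have hb1 : IsBlack (f 1) := by
      have : torAdj _ _ (f 0) (f 1) := by
        rcases hc.2.2.2 0 with h | h
        · exact h.2.1
        · exact h.2.1
      rw [EE.black_flip this]; exact hb
    refine EE.main_black (g := fun i => f (i + 1)) (k := k) hM ?_ hb1 (cycEdges k f) ?_ hA hB
    · obtain ⟨h1, h2, h3, h4⟩ := hc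
      refine ⟨h1, ?_, ?_, fun i => h4 _⟩
      · intro i hi j hj hij
        have hp : Function.Periodic f k := h3
        simp only at hij
        rw [← hp.map_mod_nat (i + 1), ← hp.map_mod_nat (j + 1)] at hij
        have : i + 1 ≡ j + 1 [MOD k] := h2 _ (Nat.mod_lt _ h1) _ (Nat.mod_lt _ h1) hij
        exact Nat.ModEq.eq_of_lt_of_lt (Nat.ModEq.add_right_cancel' 1 this) hi hj
      · intro i
        have := h3 (i + 1)
        simp only
        rw [← this]; congr 1; ring
    · intro e
      rw [hC]
      constructor
      · rintro ⟨i, rfl⟩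
        refine ⟨i + (k - 1), ?_⟩
        have e1 : i + (k - 1) + 1 = i + k := by have := hc.1; omega
        have e2 : i + k + 1 = i + 1 + k := by omega
        simp only
        rw [e1, e2, hc.2.2.1, hc.2.2.1]
      · rintro ⟨i, rfl⟩; exact ⟨i + 1, rfl⟩
end

section
/- Let m, n be positive even integers and Φ the involution M ↦ M △ U(C_M) on perfect matchings of T_{m,n}. If M is even (|M ∩ A| and |M ∩ B| both even), then Φ(M) is odd (not both |Φ(M) ∩ A| and |Φ(M) ∩ B| even). -/
open scoped symmDiff

/-- The vertex sets of the directed cycles of `D_{m,n}(M)`. -/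
def cycleVertSets (m n : ℕ) (M : Finset (Sym2 (TorV m n))) : Set (Finset (TorV m n)) :=
  {S | ∃ k f, IsDiCycle m n M k f ∧ cycVerts k f = S}

/-- lexicographic order on cells -/
def lt2 (x y : ℕ × ℕ) : Prop := x.1 < y.1 ∨ (x.1 = y.1 ∧ x.2 < y.2)

/-- cyclic adjacency of residues -/
def nadj1 (m a b : ℕ) : Prop := a + 1 = b ∨ b + 1 = a ∨ (a = 0 ∧ b + 1 = m) ∨ (b = 0 ∧ a + 1 = m)

/-- adjacency of cells -/
def nadj (m n : ℕ) (x y : ℕ × ℕ) : Prop :=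
  (x.1 = y.1 ∧ nadj1 n x.2 y.2) ∨ (x.2 = y.2 ∧ nadj1 m x.1 y.1)

/-- the top row of a vertical domino -/
def topR (a b : ℕ) : ℕ := if a + 1 = b ∨ b + 1 = a then min a b else max a b

/-- the bottom row of a vertical domino -/
def botR (a b : ℕ) : ℕ := if a + 1 = b ∨ b + 1 = a then max a b else min a b

open Classical in
/-- indicator -/
noncomputable def ind (p : Prop) : ℕ := if p then 1 else 0

theorem ind_true {p : Prop} (h : p) : ind p = 1 := if_pos h
theorem ind_false {p : Prop} (h : ¬ p) : ind p = 0 := if_neg h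

/-- vertical domino -/
def vertD (x y : ℕ × ℕ) : Prop := x.2 = y.2

/-- horizontally wrapping domino -/
def hwD (x y : ℕ × ℕ) : Prop := x.1 = y.1 ∧ ¬ (x.2 + 1 = y.2 ∨ y.2 + 1 = x.2)

/-- the half-crossing function -/
noncomputable def HH (b w b' w' : ℕ × ℕ) : ℕ :=
  ind (vertD b w) * (ind (b'.1 = topR b.1 w.1 ∧ b'.2 < b.2) + ind (w'.1 = topR b.1 w.1 ∧ w'.2 < b.2))
  + (ind (vertD b w ∧ vertD b' w' ∧ topR b'.1 w'.1 = botR b.1 w.1)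
  + ind (vertD b w ∧ hwD b' w' ∧ b'.1 = botR b.1 w.1))

/-- crossing count -/
noncomputable def XX (b w b' w' : ℕ × ℕ) : ℕ :=
  ind (lt2 w w') + ind (lt2 b b') + ind (lt2 b w') + ind (lt2 w b')

theorem topR_comm (a b : ℕ) : topR a b = topR b a := by
  unfold topR; rw [min_comm, max_comm]; simp only [or_comm]
theorem botR_comm (a b : ℕ) : botR a b = botR b a := by
  unfold botR; rw [min_comm, max_comm]; simp only [or_comm]

theorem XX_swap1 (b w b' w' : ℕ × ℕ) : XX w b b' w' = XX b w b' w' := by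
  unfold XX; ring
theorem XX_swap2 (b w b' w' : ℕ × ℕ) : XX b w w' b' = XX b w b' w' := by
  unfold XX; ring
theorem vertD_comm (x y : ℕ × ℕ) : vertD x y ↔ vertD y x := eq_comm
theorem hwD_comm (x y : ℕ × ℕ) : hwD x y ↔ hwD y x := by unfold hwD; omega

theorem HH_swap1 (b w b' w' : ℕ × ℕ) : HH w b b' w' = HH b w b' w' := by
  by_cases h : vertD b w
  · have h2 : w.2 = b.2 := h.symm
    simp only [HH, vertD_comm w b, topR_comm w.1, botR_comm w.1, h2]
  · simp only [HH, vertD_comm w b, h]; simp [ind]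
theorem HH_swap2 (b w b' w' : ℕ × ℕ) : HH b w w' b' = HH b w b' w' := by
  simp only [HH, vertD_comm w' b', topR_comm w'.1, hwD_comm w' b']
  have : (vertD b w ∧ hwD b' w' ∧ w'.1 = botR b.1 w.1) ↔ (vertD b w ∧ hwD b' w' ∧ b'.1 = botR b.1 w.1) := by
    unfold hwD; constructor <;> rintro ⟨h1, h2, h3⟩ <;> refine ⟨h1, h2, ?_⟩ <;> omega
  rw [this]; ring

/-- normal form of a domino -/
def NF (m n : ℕ) (x y : ℕ × ℕ) : Prop :=
  (x.2 = y.2 ∧ y.1 = x.1 + 1) ∨ (x.2 = y.2 ∧ x.1 = 0 ∧ y.1 + 1 = m ∧ 2 < m) ∨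
  (x.1 = y.1 ∧ y.2 = x.2 + 1) ∨ (x.1 = y.1 ∧ x.2 = 0 ∧ y.2 + 1 = n ∧ 2 < n)

theorem nadj_NF {m n : ℕ} (hm : 2 ≤ m) (hn : 2 ≤ n) {x y : ℕ × ℕ} (h : nadj m n x y) :
    NF m n x y ∨ NF m n y x := by
  unfold nadj nadj1 at h
  unfold NF
  rcases h with ⟨h0, h⟩ | ⟨h0, h⟩
  · rcases h with h | h | ⟨h, h'⟩ | ⟨h, h'⟩
    · exact Or.inl (Or.inr (Or.inr (Or.inl ⟨h0, h.symm⟩)))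
    · exact Or.inr (Or.inr (Or.inr (Or.inl ⟨h0.symm, h.symm⟩)))
    · by_cases h2 : 2 < n
      · exact Or.inl (Or.inr (Or.inr (Or.inr ⟨h0, h, h', h2⟩)))
      · exact Or.inl (Or.inr (Or.inr (Or.inl ⟨h0, by omega⟩)))
    · by_cases h2 : 2 < n
      · exact Or.inr (Or.inr (Or.inr (Or.inr ⟨h0.symm, h, h', h2⟩)))
      · exact Or.inr (Or.inr (Or.inr (Or.inl ⟨h0.symm, by omega⟩)))
  · rcases h with h | h | ⟨h, h'⟩ | ⟨h, h'⟩
    · exact Or.inl (Or.inl ⟨h0, h.symm⟩)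
    · exact Or.inr (Or.inl ⟨h0.symm, h.symm⟩)
    · by_cases h2 : 2 < m
      · exact Or.inl (Or.inr (Or.inl ⟨h0, h, h', h2⟩))
      · exact Or.inl (Or.inl ⟨h0, by omega⟩)
    · by_cases h2 : 2 < m
      · exact Or.inr (Or.inr (Or.inl ⟨h0.symm, h, h', h2⟩))
      · exact Or.inr (Or.inl ⟨h0.symm, by omega⟩)

theorem topR1 (a : ℕ) : topR a (a+1) = a := by unfold topR; simp
theorem botR1 (a : ℕ) : botR a (a+1) = a+1 := by unfold botR; simp
theorem topR2 {m a : ℕ} (h : a + 1 = m) (hm : 2 < m) : topR 0 a = a := by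
  unfold topR; rw [if_neg (by omega)]; simp
theorem botR2 {m a : ℕ} (h : a + 1 = m) (hm : 2 < m) : botR 0 a = 0 := by
  unfold botR; rw [if_neg (by omega)]; simp

theorem pair_NF {m n : ℕ} {b w b' w' : ℕ × ℕ}
    (hb : b.1 < m ∧ b.2 < n) (hw : w.1 < m ∧ w.2 < n)
    (hb' : b'.1 < m ∧ b'.2 < n) (hw' : w'.1 < m ∧ w'.2 < n)
    (h : NF m n b w) (h' : NF m n b' w')
    (h1 : b ≠ b') (h2 : w ≠ w') (h3 : b ≠ w') (h4 : w ≠ b') :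
    (XX b w b' w' + HH b w b' w' + HH b' w' b w) % 2 = 0 := by
  obtain ⟨b1, b2⟩ := b
  obtain ⟨w1, w2⟩ := w
  obtain ⟨x1, x2⟩ := b'
  obtain ⟨y1, y2⟩ := w'
  simp only [ne_eq, Prod.mk.injEq, NF] at *
  rcases h with ⟨rfl, rfl⟩ | ⟨rfl, rfl, h, hh⟩ | ⟨rfl, rfl⟩ | ⟨rfl, rfl, h, hh⟩ <;>
  rcases h' with ⟨rfl, rfl⟩ | ⟨rfl, rfl, h', hh'⟩ | ⟨rfl, rfl⟩ | ⟨rfl, rfl, h', hh'⟩ <;>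
  (try have t1 := topR2 h hh) <;> (try have t2 := topR2 h' hh') <;>
  (try have t3 := botR2 h hh) <;> (try have t4 := botR2 h' hh') <;>
  simp only [XX, HH, lt2, vertD, hwD, topR1, botR1, *] <;>
  unfold ind <;> grind

theorem pair_all {m n : ℕ} (hm : 2 ≤ m) (hn : 2 ≤ n) {b w b' w' : ℕ × ℕ}
    (hb : b.1 < m ∧ b.2 < n) (hw : w.1 < m ∧ w.2 < n)
    (hb' : b'.1 < m ∧ b'.2 < n) (hw' : w'.1 < m ∧ w'.2 < n)
    (h : nadj m n b w) (h' : nadj m n b' w')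
    (h1 : b ≠ b') (h2 : w ≠ w') (h3 : b ≠ w') (h4 : w ≠ b') :
    (XX b w b' w' + HH b w b' w' + HH b' w' b w) % 2 = 0 := by
  rcases nadj_NF hm hn h with k | k <;> rcases nadj_NF hm hn h' with k' | k'
  · exact pair_NF hb hw hb' hw' k k' h1 h2 h3 h4
  · have := pair_NF hb hw hw' hb' k k' h3 h4 h1 h2
    rwa [XX_swap2, HH_swap2 b w b' w', HH_swap1 b' w' b w] at this
  · have := pair_NF hw hb hb' hw' k k' h4 h3 h2 h1
    rwa [XX_swap1, HH_swap1 b w b' w', HH_swap2 b' w' b w] at this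
  · have := pair_NF hw hb hw' hb' k k' h2 h1 h4 h3
    rwa [XX_swap1, XX_swap2, HH_swap1 b w w' b', HH_swap2 b w b' w',
      HH_swap1 b' w' w b, HH_swap2 b' w' b w] at this

theorem HH_self {m n : ℕ} (hm : 2 ≤ m) (hn : 2 ≤ n) {b w : ℕ × ℕ} (h : nadj m n b w) :
    HH b w b w = 0 := by
  have key : ∀ b w : ℕ × ℕ, NF m n b w → HH b w b w = 0 := by
    rintro ⟨b1, b2⟩ ⟨w1, w2⟩ h
    simp only [NF] at h
    rcases h with ⟨rfl, rfl⟩ | ⟨rfl, rfl, h, hh⟩ | ⟨rfl, rfl⟩ | ⟨rfl, rfl, h, hh⟩ <;>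
    (try have t1 := topR2 h hh) <;> 
    (try have t3 := botR2 h hh) <;> 
    simp only [HH, vertD, hwD, topR1, botR1, *] <;>
    unfold ind <;> grind
  rcases nadj_NF hm hn h with k | k
  · exact key _ _ k
  · rw [← HH_swap1, ← HH_swap2]; exact key _ _ k

/-- A domino tiling of the torus in coordinates. -/
structure Tiling (m n N : ℕ) (b w : Fin N → ℕ × ℕ) : Prop where
  bb : ∀ i, (b i).1 < m ∧ (b i).2 < n
  wb : ∀ i, (w i).1 < m ∧ (w i).2 < n
  adj : ∀ i, nadj m n (b i) (w i)
  binj : Function.Injective b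
  winj : Function.Injective w
  disj : ∀ i j, b i ≠ w j
  cover : ∀ F : ℕ × ℕ → ZMod 2, ∑ i, F (b i) + ∑ i, F (w i) =
    ∑ x ∈ Finset.range m ×ˢ Finset.range n, F x
  even : ∑ i, (ind (vertD (b i) (w i) ∧ botR (b i).1 (w i).1 = 0) : ZMod 2) = 0

theorem z2_add_self (x : ZMod 2) : x + x = 0 := CharTwo.add_self_eq_zero x

theorem tb_cases {m n : ℕ} (hm : 2 ≤ m) (hn : 2 ≤ n) {b w : ℕ × ℕ} (h : nadj m n b w)
    (hv : vertD b w) :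
    ((topR b.1 w.1 = b.1 ∧ botR b.1 w.1 = w.1) ∨ (topR b.1 w.1 = w.1 ∧ botR b.1 w.1 = b.1)) ∧
    (botR b.1 w.1 = topR b.1 w.1 + 1 ∨ (botR b.1 w.1 = 0 ∧ topR b.1 w.1 + 1 = m)) := by
  have key : ∀ b w : ℕ × ℕ, NF m n b w → vertD b w →
      ((topR b.1 w.1 = b.1 ∧ botR b.1 w.1 = w.1) ∨ (topR b.1 w.1 = w.1 ∧ botR b.1 w.1 = b.1)) ∧
      (botR b.1 w.1 = topR b.1 w.1 + 1 ∨ (botR b.1 w.1 = 0 ∧ topR b.1 w.1 + 1 = m)) := by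
    rintro ⟨b1, b2⟩ ⟨w1, w2⟩ h hv
    simp only [NF, vertD] at h hv ⊢
    rcases h with ⟨rfl, rfl⟩ | ⟨rfl, rfl, h, hh⟩ | ⟨rfl, rfl⟩ | ⟨rfl, rfl, h, hh⟩
    · simp [topR1, botR1]
    · simp [topR2 h hh, botR2 h hh, h]
    · omega
    · omega
  rcases nadj_NF hm hn h with k | k
  · exact key _ _ k hv
  · have := key _ _ k hv.symm
    rw [topR_comm, botR_comm] at this
    tauto

theorem row_eq {m n : ℕ} {b w : ℕ × ℕ} (h : nadj m n b w)
    (hv : ¬ vertD b w) : b.1 = w.1 := by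
  unfold nadj at h
  rcases h with h | h
  · exact h.1
  · exact absurd h.1 hv

theorem Tiling.vbot {m n N : ℕ} {b w : Fin N → ℕ × ℕ} (T : Tiling m n N b w)
    (hm : 2 ≤ m) (hn : 2 ≤ n) (hne : Even n) (t : ℕ) (ht : t < m) :
    ∑ i, (ind (vertD (b i) (w i) ∧ botR (b i).1 (w i).1 = t) : ZMod 2) = 0 := by
  induction t with
  | zero => exact T.even
  | succ t ih =>
    have ih := ih (by omega)
    have h1 := T.cover (fun x => (ind (x.1 = t) : ZMod 2))
    have h2 : ∑ x ∈ Finset.range m ×ˢ Finset.range n, (ind (x.1 = t) : ZMod 2) = 0 := by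
      rw [Finset.sum_product]
      apply Finset.sum_eq_zero
      intro i _
      simp only [Finset.sum_const, Finset.card_range, nsmul_eq_mul]
      rw [(ZMod.natCast_eq_zero_iff_even).2 hne, zero_mul]
    rw [h2, ← Finset.sum_add_distrib] at h1
    have h3 : ∀ i, ((ind ((b i).1 = t) : ZMod 2) + ind ((w i).1 = t)) =
        ind (vertD (b i) (w i) ∧ botR (b i).1 (w i).1 = t) +
        ind (vertD (b i) (w i) ∧ botR (b i).1 (w i).1 = t + 1) := by
      intro i
      by_cases hv : vertD (b i) (w i)
      · have := tb_cases hm hn (T.adj i) hv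
        have e : (botR (b i).1 (w i).1 = t + 1) ↔ topR (b i).1 (w i).1 = t := by omega
        simp only [hv, true_and, e]
        rcases this.1 with ⟨a1, a2⟩ | ⟨a1, a2⟩
        · rw [a1, a2, add_comm]
        · rw [a1, a2]
      · simp only [hv, false_and]
        rw [row_eq (T.adj i) hv, z2_add_self, z2_add_self]
    rw [Finset.sum_congr rfl (fun i _ => h3 i), Finset.sum_add_distrib, ih, zero_add] at h1
    exact h1

theorem Tiling.sumH {m n N : ℕ} {b w : Fin N → ℕ × ℕ} (T : Tiling m n N b w)
    (hm : 2 ≤ m) (hn : 2 ≤ n) (hne : Even n) :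
    ∑ i, ∑ j, (HH (b i) (w i) (b j) (w j) : ZMod 2) =
      ∑ i, (ind (vertD (b i) (w i)) : ZMod 2) * ((b i).2 : ℕ) := by
  have split : ∑ i, ∑ j, (HH (b i) (w i) (b j) (w j) : ZMod 2) =
    ∑ i, (ind (vertD (b i) (w i)) : ZMod 2) *
      (∑ j, (ind ((b j).1 = topR (b i).1 (w i).1 ∧ (b j).2 < (b i).2) : ZMod 2) +
       ∑ j, (ind ((w j).1 = topR (b i).1 (w i).1 ∧ (w j).2 < (b i).2) : ZMod 2)) +
    (∑ j, ∑ i, (ind (vertD (b i) (w i) ∧ vertD (b j) (w j) ∧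
        topR (b j).1 (w j).1 = botR (b i).1 (w i).1) : ZMod 2) +
     ∑ j, ∑ i, (ind (vertD (b i) (w i) ∧ hwD (b j) (w j) ∧
        (b j).1 = botR (b i).1 (w i).1) : ZMod 2)) := by
    rw [Finset.sum_comm (f := fun j i => (ind (vertD (b i) (w i) ∧ vertD (b j) (w j) ∧
        topR (b j).1 (w j).1 = botR (b i).1 (w i).1) : ZMod 2)),
      Finset.sum_comm (f := fun j i => (ind (vertD (b i) (w i) ∧ hwD (b j) (w j) ∧
        (b j).1 = botR (b i).1 (w i).1) : ZMod 2)), ← Finset.sum_add_distrib,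
        ← Finset.sum_add_distrib]
    apply Finset.sum_congr rfl
    intro i _
    rw [← Finset.sum_add_distrib, ← Finset.sum_add_distrib, Finset.mul_sum,
      ← Finset.sum_add_distrib]
    apply Finset.sum_congr rfl
    intro j _
    unfold HH
    push_cast
    ring
  rw [split]
  have z1 : ∑ j, ∑ i, (ind (vertD (b i) (w i) ∧ vertD (b j) (w j) ∧
        topR (b j).1 (w j).1 = botR (b i).1 (w i).1) : ZMod 2) = 0 := by
    apply Finset.sum_eq_zero
    intro j _
    by_cases hv : vertD (b j) (w j)
    · have lt : topR (b j).1 (w j).1 < m := by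
        have := tb_cases hm hn (T.adj j) hv
        have := (T.bb j).1
        have := (T.wb j).1
        omega
      simp only [hv, true_and, eq_comm (a := topR (b j).1 (w j).1)]
      exact T.vbot hm hn hne _ lt
    · simp [hv, ind]
  have z2 : ∑ j, ∑ i, (ind (vertD (b i) (w i) ∧ hwD (b j) (w j) ∧
        (b j).1 = botR (b i).1 (w i).1) : ZMod 2) = 0 := by
    apply Finset.sum_eq_zero
    intro j _
    by_cases hv : hwD (b j) (w j)
    · simp only [hv, true_and, eq_comm (a := (b j).1)]
      exact T.vbot hm hn hne _ (T.bb j).1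
    · simp [hv, ind]
  rw [z1, z2, add_zero, add_zero]
  apply Finset.sum_congr rfl
  intro i _
  by_cases hv : vertD (b i) (w i)
  · have lt : topR (b i).1 (w i).1 < m := by
      have := tb_cases hm hn (T.adj i) hv
      have := (T.bb i).1
      have := (T.wb i).1
      omega
    congr 1
    rw [T.cover (fun x => (ind (x.1 = topR (b i).1 (w i).1 ∧ x.2 < (b i).2) : ZMod 2)),
      Finset.sum_product, Finset.sum_eq_single (topR (b i).1 (w i).1)]
    · simp only [true_and, ind, Nat.cast_ite, Nat.cast_one, Nat.cast_zero]
      rw [Finset.sum_ite, Finset.sum_const_zero, add_zero, Finset.sum_const, nsmul_eq_mul, mul_one]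
      congr 1
      have : Finset.filter (fun x => x < (b i).2) (Finset.range n) = Finset.range (b i).2 := by
        ext x
        have := (T.bb i).2
        simp only [Finset.mem_filter, Finset.mem_range]
        omega
      rw [this, Finset.card_range]
    · intro r _ hr
      simp [hr, ind]
    · intro h
      exact absurd (Finset.mem_range.2 lt) h
  · simp [hv, ind]

/-- sign of a comparison -/
noncomputable def sg (x y : ℕ × ℕ) : ℤ := (ind (lt2 x y) : ℤ) - (ind (lt2 y x) : ℤ)

theorem sg_anti (x y : ℕ × ℕ) : sg x y = - sg y x := by unfold sg; ring

theorem ind_lt2_flip {x y : ℕ × ℕ} (h : x ≠ y) : ind (lt2 x y) + ind (lt2 y x) = 1 := by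
  have : x.1 ≠ y.1 ∨ x.2 ≠ y.2 := by
    by_contra hh
    push Not at hh
    exact h (Prod.ext hh.1 hh.2)
  unfold ind lt2
  split_ifs <;> omega

theorem sg_eq {x y : ℕ × ℕ} (h : x ≠ y) : sg x y = -(-1) ^ ind (lt2 x y) := by
  have := ind_lt2_flip h
  unfold sg
  have : ind (lt2 x y) = 0 ∨ ind (lt2 x y) = 1 := by omega
  rcases this with h | h
  · rw [h, show ind (lt2 y x) = 1 by omega]; simp
  · rw [h, show ind (lt2 y x) = 0 by omega]; simp

/-- half inversions -/
noncomputable def KK (b w b' w' : ℕ × ℕ) : ℕ := HH b w b' w' + ind (lt2 b w')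

theorem Tiling.pair {m n N : ℕ} {b w : Fin N → ℕ × ℕ} (T : Tiling m n N b w)
    (hm : 2 ≤ m) (hn : 2 ≤ n) {i j : Fin N} (hij : i ≠ j) :
    sg (w i) (w j) = - sg (b i) (b j) *
      (-1) ^ (KK (b j) (w j) (b i) (w i) + KK (b i) (w i) (b j) (w j)) := by
  have h := pair_all hm hn (T.bb i) (T.wb i) (T.bb j) (T.wb j) (T.adj i) (T.adj j)
    (T.binj.ne hij) (T.winj.ne hij) (T.disj i j) (T.disj j i).symm
  rw [sg_eq (T.binj.ne hij), sg_eq (T.winj.ne hij), neg_neg, ← pow_add]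
  rw [← neg_one_mul, ← pow_succ']
  have f := ind_lt2_flip (T.disj j i)
  unfold XX at h
  unfold KK
  rw [neg_one_pow_eq_pow_mod_two, neg_one_pow_eq_pow_mod_two (n := _ + _)]
  congr 1
  omega

theorem Tiling.total {m n N : ℕ} {b w : Fin N → ℕ × ℕ} (T : Tiling m n N b w)
    (hm : 2 ≤ m) (hn : 2 ≤ n) :
    ∏ j, ∏ i ∈ Finset.Iio j, sg (w i) (w j) =
     (∏ j, ∏ i ∈ Finset.Iio j, - sg (b i) (b j)) *
      (-1) ^ (∑ i, ∑ j ∈ {i}ᶜ, KK (b j) (w j) (b i) (w i)) := by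
  have h := Finset.prod_prod_Ioi_mul_eq_prod_prod_off_diag
    (fun i j : Fin N => (-1 : ℤ) ^ (KK (b i) (w i) (b j) (w j)))
  simp only [Finset.prod_pow_eq_pow_sum] at h
  rw [← h]
  have h2 : ∏ j, ∏ i ∈ Finset.Ioi j, (-1 : ℤ) ^ (KK (b i) (w i) (b j) (w j)) *
      (-1 : ℤ) ^ (KK (b j) (w j) (b i) (w i)) =
      ∏ i, ∏ j ∈ Finset.Iio i, (-1 : ℤ) ^ (KK (b i) (w i) (b j) (w j)) *
      (-1 : ℤ) ^ (KK (b j) (w j) (b i) (w i)) := by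
    apply Finset.prod_comm'
    simp
  rw [h2, ← Finset.prod_mul_distrib]
  apply Finset.prod_congr rfl
  intro j _
  rw [← Finset.prod_mul_distrib]
  apply Finset.prod_congr rfl
  intro i hi
  rw [T.pair hm hn (Finset.mem_Iio.1 hi).ne, ← pow_add]

/-- single domino statistic -/
noncomputable def ee (b w : ℕ × ℕ) : ZMod 2 := ind (vertD b w) * (b.2 : ℕ) + ind (lt2 b w)

theorem Tiling.sumK {m n N : ℕ} {b w : Fin N → ℕ × ℕ} (T : Tiling m n N b w)
    (hm : 2 ≤ m) (hn : 2 ≤ n) (hne : Even n) :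
    ((∑ i, ∑ j ∈ {i}ᶜ, KK (b j) (w j) (b i) (w i) : ℕ) : ZMod 2) =
      ∑ i, ee (b i) (w i) + ∑ j, ∑ i, (ind (lt2 (b i) (w j)) : ZMod 2) := by
  have h1 : ∀ i, ((∑ j ∈ {i}ᶜ, KK (b j) (w j) (b i) (w i) : ℕ) : ZMod 2) =
      ∑ j, (HH (b j) (w j) (b i) (w i) : ZMod 2) + ∑ j, (ind (lt2 (b j) (w i)) : ZMod 2)
      + ind (lt2 (b i) (w i)) := by
    intro i
    have := Fintype.sum_eq_add_sum_compl i (fun j => (KK (b j) (w j) (b i) (w i) : ZMod 2))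
    rw [← Finset.sum_add_distrib]
    have e : ∀ j, (HH (b j) (w j) (b i) (w i) : ZMod 2) + (ind (lt2 (b j) (w i)) : ZMod 2) =
      (KK (b j) (w j) (b i) (w i) : ZMod 2) := by
      intro j; unfold KK; push_cast; rfl
    simp only [e]
    rw [this]
    push_cast
    have : KK (b i) (w i) (b i) (w i) = ind (lt2 (b i) (w i)) := by
      unfold KK; rw [HH_self hm hn (T.adj i), zero_add]
    rw [this]
    have := z2_add_self (ind (lt2 (b i) (w i)) : ZMod 2)
    linear_combination -this
  rw [Nat.cast_sum, Finset.sum_congr rfl (fun i _ => h1 i), Finset.sum_add_distrib,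
    Finset.sum_add_distrib, Finset.sum_comm, T.sumH hm hn hne]
  unfold ee
  rw [Finset.sum_add_distrib]
  ring

theorem sg_pm {x y : ℕ × ℕ} (h : x ≠ y) : sg x y ≠ 0 := by
  rw [sg_eq h]; simp

theorem core {m n N : ℕ} {b w w' : Fin N → ℕ × ℕ} (T : Tiling m n N b w)
    (T' : Tiling m n N b w') (hm : 2 ≤ m) (hn : 2 ≤ n) (hne : Even n)
    (τ : Equiv.Perm (Fin N)) (hτ : ∀ i, w' (τ i) = w i) (c : ℕ)
    (hc : ∑ i, (ee (b i) (w i) + ee (b (τ i)) (w i)) = (c : ZMod 2)) :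
    ((Equiv.Perm.sign τ : ℤˣ) : ℤ) = (-1) ^ c := by
  have h := Equiv.Perm.prod_Iio_comp_eq_sign_mul_prod τ (f := fun i j => sg (w' i) (w' j))
    (fun i j => sg_anti _ _)
  simp only [hτ] at h
  rw [T.total hm hn, T'.total hm hn] at h
  have hP : (∏ j, ∏ i ∈ Finset.Iio j, - sg (b i) (b j)) ≠ 0 := by
    rw [Finset.prod_ne_zero_iff]
    intro j _
    rw [Finset.prod_ne_zero_iff]
    intro i hi
    rw [neg_ne_zero]
    exact sg_pm (T.binj.ne (Finset.mem_Iio.1 hi).ne)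
  have k1 := T.sumK hm hn hne
  have k2 := T'.sumK hm hn hne
  have r1 : ∑ i, ee (b i) (w' i) = ∑ i, ee (b (τ i)) (w i) := by
    rw [← Equiv.sum_comp τ]
    simp only [hτ]
  have r2 : ∑ j, ∑ i, (ind (lt2 (b i) (w' j)) : ZMod 2) =
      ∑ j, ∑ i, (ind (lt2 (b i) (w j)) : ZMod 2) := by
    rw [← Equiv.sum_comp τ]
    simp only [hτ]
  rw [r1, r2] at k2
  rw [Finset.sum_add_distrib] at hc
  generalize (∑ i, ∑ j ∈ {i}ᶜ, KK (b j) (w j) (b i) (w i) : ℕ) = s1 at *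
  generalize (∑ i, ∑ j ∈ {i}ᶜ, KK (b j) (w' j) (b i) (w' i) : ℕ) = s2 at *
  have hs : ((s1 : ℕ) : ZMod 2) = ((s2 + c : ℕ) : ZMod 2) := by
    push_cast
    rw [k1, k2, ← hc]
    have := z2_add_self (∑ i, ee (b (τ i)) (w i))
    linear_combination -this
  have hs2 : (-1 : ℤ) ^ s1 = (-1) ^ s2 * (-1) ^ c := by
    rw [← pow_add, neg_one_pow_eq_pow_mod_two, neg_one_pow_eq_pow_mod_two (n := s2 + c)]
    rw [(ZMod.natCast_eq_natCast_iff' _ _ _).1 hs]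
  rw [hs2] at h
  have hq : (-1 : ℤ) ^ s2 ≠ 0 := by simp
  apply mul_right_cancel₀ (mul_ne_zero hP hq)
  simp only [Int.cast_id] at h
  rw [← h]
  ring

/-- wrap-around vertical pair, in coordinates -/
def wA (m : ℕ) (x y : ℕ × ℕ) : Prop :=
  x.2 = y.2 ∧ ((x.1 = 0 ∧ y.1 + 1 = m) ∨ (y.1 = 0 ∧ x.1 + 1 = m))

/-- wrap-around horizontal pair, in coordinates -/
def wB (n : ℕ) (x y : ℕ × ℕ) : Prop :=
  x.1 = y.1 ∧ ((x.2 = 0 ∧ y.2 + 1 = n) ∨ (y.2 = 0 ∧ x.2 + 1 = n))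

theorem bot_zero {m n : ℕ} (hm : 2 ≤ m) (hn : 2 ≤ n) {b w : ℕ × ℕ} (h : nadj m n b w) :
    (vertD b w ∧ botR b.1 w.1 = 0) ↔ (2 < m ∧ wA m b w) := by
  have key : ∀ b w : ℕ × ℕ, NF m n b w →
      ((vertD b w ∧ botR b.1 w.1 = 0) ↔ (2 < m ∧ wA m b w)) := by
    rintro ⟨b1, b2⟩ ⟨w1, w2⟩ h
    simp only [NF, vertD, wA] at h ⊢
    rcases h with ⟨rfl, rfl⟩ | ⟨rfl, rfl, h, hh⟩ | ⟨rfl, rfl⟩ | ⟨rfl, rfl, h, hh⟩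
    · simp only [botR1]; omega
    · simp [botR2 h hh, h, hh]
    · omega
    · omega
  rcases nadj_NF hm hn h with k | k
  · exact key _ _ k
  · have := key _ _ k
    rw [botR_comm, vertD_comm] at this
    rw [this]
    unfold wA
    omega

theorem local_step {m n : ℕ} (hm : 2 ≤ m) (hn : 2 ≤ n) {x y z : ℕ × ℕ}
    (hx : x.1 < m ∧ x.2 < n) (hy : y.1 < m ∧ y.2 < n) (hz : z.1 < m ∧ z.2 < n)
    (h1 : nadj m n x y) (h2 : nadj m n y z)
    (hcol : (x.1 = y.1 ∧ y.1 = z.1) ∨ (x.2 = y.2 ∧ y.2 = z.2)) (hne : x ≠ z) :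
    ee x y + ee z y = 1 + (ind (wA m x y) + ind (wB n x y) + (ind (wA m z y) + ind (wB n z y))) := by
  obtain ⟨x1, x2⟩ := x
  obtain ⟨y1, y2⟩ := y
  obtain ⟨z1, z2⟩ := z
  simp only [ne_eq, Prod.mk.injEq, nadj, nadj1] at *
  rcases hcol with ⟨rfl, rfl⟩ | ⟨rfl, rfl⟩
  · have e1 : ¬ x2 = y2 := by omega
    have e2 : ¬ z2 = y2 := by omega
    have : (ind (lt2 (x1, x2) (x1, y2)) + ind (lt2 (x1, z2) (x1, y2))) % 2 =
      (1 + (ind (wA m (x1, x2) (x1, y2)) + ind (wB n (x1, x2) (x1, y2)) +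
        (ind (wA m (x1, z2) (x1, y2)) + ind (wB n (x1, z2) (x1, y2))))) % 2 := by
      simp only [lt2, wA, wB, e1, e2, ind, lt_irrefl, true_and, false_and, false_or, if_false]
      split_ifs <;> omega
    simp only [ee, vertD, e1, e2, ind_false not_false]
    have := (ZMod.natCast_eq_natCast_iff' _ _ 2).2 this
    push_cast at this ⊢
    rw [← this]
    ring
  · have e1 : ¬ x1 = y1 := by omega
    have e2 : ¬ z1 = y1 := by omega
    have : (ind (lt2 (x1, x2) (y1, x2)) + ind (lt2 (z1, x2) (y1, x2))) % 2 =
      (1 + (ind (wA m (x1, x2) (y1, x2)) + ind (wB n (x1, x2) (y1, x2)) +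
        (ind (wA m (z1, x2) (y1, x2)) + ind (wB n (z1, x2) (y1, x2))))) % 2 := by
      simp only [lt2, wA, wB, e1, e2, ind, true_and, false_and, or_false, if_false]
      split_ifs <;> omega
    simp only [ee, vertD, ind_true trivial]
    have := (ZMod.natCast_eq_natCast_iff' _ _ 2).2 this
    push_cast at this ⊢
    rw [← this]
    have := z2_add_self (x2 : ZMod 2)
    linear_combination this

/-- coordinates of a vertex -/
def cell {m n : ℕ} (v : TorV m n) : ℕ × ℕ := (v.1.val, v.2.val)

theorem cell_inj {m n : ℕ} [NeZero m] [NeZero n] {u v : TorV m n} (h : cell u = cell v) : u = v := by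
  simp only [cell, Prod.mk.injEq] at h
  exact Prod.ext (ZMod.val_injective m h.1) (ZMod.val_injective n h.2)

theorem cell_lt {m n : ℕ} [NeZero m] [NeZero n] (v : TorV m n) :
    (cell v).1 < m ∧ (cell v).2 < n := ⟨ZMod.val_lt _, ZMod.val_lt _⟩

theorem val_succ {m : ℕ} [NeZero m] (hm : 2 ≤ m) (b : ZMod m) :
    b.val + 1 = (b + 1).val ∨ ((b + 1).val = 0 ∧ b.val + 1 = m) := by
  have h1 : (1 : ZMod m).val = 1 := by
    have : Fact (1 < m) := ⟨hm⟩
    exact ZMod.val_one m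
  have hb := ZMod.val_lt b
  rw [ZMod.val_add, h1]
  by_cases h : b.val + 1 = m
  · right; rw [h]; simp
  · left; rw [Nat.mod_eq_of_lt (by omega)]

theorem cell_adj {m n : ℕ} [NeZero m] [NeZero n] (hm : 2 ≤ m) (hn : 2 ≤ n) {u v : TorV m n}
    (h : torAdj m n u v) : nadj m n (cell u) (cell v) := by
  obtain ⟨u1, u2⟩ := u
  obtain ⟨v1, v2⟩ := v
  simp only [torAdj, nadj, cell, nadj1] at *
  rcases h with ⟨rfl, rfl | rfl⟩ | ⟨rfl, rfl | rfl⟩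
  · have := val_succ hn v2; left; exact ⟨rfl, by omega⟩
  · have := val_succ hn u2; left; exact ⟨rfl, by omega⟩
  · have := val_succ hm v1; right; exact ⟨rfl, by omega⟩
  · have := val_succ hm u1; right; exact ⟨rfl, by omega⟩

theorem adj_color {m n : ℕ} [NeZero m] [NeZero n] (hm : Even m) (hn : Even n)
    (hm2 : 2 ≤ m) (hn2 : 2 ≤ n) {u v : TorV m n}
    (h : torAdj m n u v) : IsBlack u ↔ ¬ IsBlack v := by
  have h := cell_adj hm2 hn2 h
  simp only [nadj, cell, nadj1] at h
  unfold IsBlack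
  obtain ⟨a, rfl⟩ := hm
  obtain ⟨c, rfl⟩ := hn
  rw [Nat.even_iff, Nat.even_iff]
  omega

theorem adj_symm {m n : ℕ} {u v : TorV m n} (h : torAdj m n u v) : torAdj m n v u := by
  unfold torAdj at *
  rcases h with ⟨h1, h2⟩ | ⟨h1, h2⟩
  · exact Or.inl ⟨h1.symm, h2.symm⟩
  · exact Or.inr ⟨h1.symm, h2.symm⟩

theorem val_neg_one' {m : ℕ} [NeZero m] (x : ZMod m) : x.val + 1 = m ↔ x = -1 := by
  have hm : 0 < m := NeZero.pos m
  obtain ⟨k, rfl⟩ : ∃ k, m = k + 1 := ⟨m - 1, by omega⟩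
  constructor
  · intro h
    apply ZMod.val_injective
    rw [ZMod.val_neg_one]
    omega
  · rintro rfl
    rw [ZMod.val_neg_one]

theorem memA {m n : ℕ} [NeZero m] [NeZero n] (u v : TorV m n) :
    s(u, v) ∈ layerA m n ↔ wA m (cell u) (cell v) := by
  obtain ⟨u1, u2⟩ := u
  obtain ⟨v1, v2⟩ := v
  simp only [layerA, wA, cell, Finset.mem_image, Finset.mem_univ, true_and, Sym2.eq_iff,
    Prod.mk.injEq, ZMod.val_eq_zero, val_neg_one', (ZMod.val_injective n).eq_iff]
  constructor
  · rintro ⟨j, ⟨⟨rfl, rfl⟩, rfl, rfl⟩ | ⟨⟨rfl, rfl⟩, rfl, rfl⟩⟩ <;> simp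
  · rintro ⟨rfl, ⟨rfl, rfl⟩ | ⟨rfl, rfl⟩⟩ <;> exact ⟨u2, by simp⟩

theorem memB {m n : ℕ} [NeZero m] [NeZero n] (u v : TorV m n) :
    s(u, v) ∈ layerB m n ↔ wB n (cell u) (cell v) := by
  obtain ⟨u1, u2⟩ := u
  obtain ⟨v1, v2⟩ := v
  simp only [layerB, wB, cell, Finset.mem_image, Finset.mem_univ, true_and, Sym2.eq_iff,
    Prod.mk.injEq, ZMod.val_eq_zero, val_neg_one', (ZMod.val_injective m).eq_iff]
  constructor
  · rintro ⟨j, ⟨⟨rfl, rfl⟩, rfl, rfl⟩ | ⟨⟨rfl, rfl⟩, rfl, rfl⟩⟩ <;> simp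
  · rintro ⟨rfl, ⟨rfl, rfl⟩ | ⟨rfl, rfl⟩⟩ <;> exact ⟨u1, by simp⟩

/-- black vertices -/
abbrev BV (m n : ℕ) := {v : TorV m n // IsBlack v}

noncomputable instance (m n : ℕ) [NeZero m] [NeZero n] : Fintype (BV m n) := by
  classical
  unfold BV
  infer_instance

/-- A perfect matching as a map from black vertices to white ones. -/
structure GoodM (m n : ℕ) (g : BV m n → TorV m n) : Prop where
  adj : ∀ b : BV m n, torAdj m n b.1 (g b)
  inj : Function.Injective g
  white : ∀ b, ¬ IsBlack (g b)
  surj : ∀ v, ¬ IsBlack v → ∃ b, g b = v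

theorem sum_cells {m n : ℕ} [NeZero m] [NeZero n] (F : ℕ × ℕ → ZMod 2) :
    ∑ v : TorV m n, F (cell v) = ∑ x ∈ Finset.range m ×ˢ Finset.range n, F x := by
  apply Finset.sum_bij (fun v _ => cell v)
  · intro v _
    have := cell_lt v
    simpa using this
  · intro u _ v _ h
    exact cell_inj h
  · rintro ⟨i, j⟩ h
    simp only [Finset.mem_product, Finset.mem_range] at h
    refine ⟨((i : ZMod m), (j : ZMod n)), Finset.mem_univ _, ?_⟩
    simp [cell, ZMod.val_cast_of_lt h.1, ZMod.val_cast_of_lt h.2]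
  · intros; rfl

theorem GoodM.tiling {m n : ℕ} [NeZero m] [NeZero n] (hm2 : 2 ≤ m) (hn2 : 2 ≤ n)
    {g : BV m n → TorV m n} (G : GoodM m n g)
    (hA : ∑ b : BV m n, (ind (wA m (cell b.1) (cell (g b))) : ZMod 2) = 0)
    {N : ℕ} (e : Fin N ≃ BV m n) :
    Tiling m n N (fun i => cell (e i).1) (fun i => cell (g (e i))) where
  bb i := cell_lt _
  wb i := cell_lt _
  adj i := cell_adj hm2 hn2 (G.adj _)
  binj i j h := e.injective (Subtype.ext (cell_inj h))
  winj i j h := e.injective (G.inj (cell_inj h))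
  disj i j h := by
    have h := cell_inj h
    exact G.white (e j) (h ▸ (e i).2)
  cover F := by
    classical
    rw [← sum_cells F]
    rw [Equiv.sum_comp e (fun b : BV m n => F (cell b.1)),
      Equiv.sum_comp e (fun b : BV m n => F (cell (g b)))]
    rw [← Finset.sum_filter_add_sum_filter_not Finset.univ (fun v : TorV m n => IsBlack v)]
    congr 1
    · apply Finset.sum_bij (fun (b : BV m n) _ => b.1)
      · intro b _; simp [b.2]
      · intro a _ b _ h; exact Subtype.ext h
      · intro v hv; exact ⟨⟨v, by simpa using hv⟩, Finset.mem_univ _, rfl⟩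
      · intros; rfl
    · apply Finset.sum_bij (fun (b : BV m n) _ => g b)
      · intro b _; simp [G.white b]
      · intro a _ b _ h; exact G.inj h
      · intro v hv
        obtain ⟨b, hb⟩ := G.surj v (by simpa using hv)
        exact ⟨b, Finset.mem_univ _, hb⟩
      · intros; rfl
  even := by
    have : ∀ i, (vertD (cell (e i).1) (cell (g (e i))) ∧
        botR (cell (e i).1).1 (cell (g (e i))).1 = 0) ↔
        (2 < m ∧ wA m (cell (e i).1) (cell (g (e i)))) :=
      fun i => bot_zero hm2 hn2 (cell_adj hm2 hn2 (G.adj _))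
    simp only [this]
    by_cases h : 2 < m
    · simp only [h, true_and]
      rw [Equiv.sum_comp e (fun b : BV m n => (ind (wA m (cell b.1) (cell (g b))) : ZMod 2))]
      exact hA
    · simp [h, ind]

theorem core2 {m n : ℕ} [NeZero m] [NeZero n] (hm2 : 2 ≤ m) (hn2 : 2 ≤ n) (hne : Even n)
    {g g' : BV m n → TorV m n} (G : GoodM m n g) (G' : GoodM m n g')
    (hA : ∑ b : BV m n, (ind (wA m (cell b.1) (cell (g b))) : ZMod 2) = 0)
    (hA' : ∑ b : BV m n, (ind (wA m (cell b.1) (cell (g' b))) : ZMod 2) = 0)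
    [DecidableEq (BV m n)]
    (τ : Equiv.Perm (BV m n)) (hτ : ∀ b, g' (τ b) = g b) (c : ℕ)
    (hc : ∑ b : BV m n, (ee (cell b.1) (cell (g b)) + ee (cell (τ b).1) (cell (g b))) =
      (c : ZMod 2)) :
    ((Equiv.Perm.sign τ : ℤˣ) : ℤ) = (-1) ^ c := by
  let e : Fin (Fintype.card (BV m n)) ≃ BV m n := (Fintype.equivFin (BV m n)).symm
  have := core (G.tiling hm2 hn2 hA e) (G'.tiling hm2 hn2 hA' e) hm2 hn2 hne
    (e.symm.permCongr τ) (fun i => by simp [Equiv.permCongr_apply, hτ]) c (by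
      rw [← hc, ← Equiv.sum_comp e]
      apply Finset.sum_congr rfl
      intro i _
      simp [Equiv.permCongr_apply])
  rwa [Equiv.Perm.sign_permCongr] at this

theorem card_layer {m n : ℕ} [NeZero m] [NeZero n] (X S : Finset (Sym2 (TorV m n)))
    (x : BV m n → BV m n) (y : BV m n → TorV m n) (hy : Function.Injective y)
    (hw : ∀ b, ¬ IsBlack (y b)) (hX : ∀ e, e ∈ X ↔ ∃ b, e = s((x b).1, y b)) :
    ((X ∩ S).card : ZMod 2) = ∑ b, (ind (s((x b).1, y b) ∈ S) : ZMod 2) := by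
  classical
  have hinj : Function.Injective (fun b => s((x b).1, y b)) := by
    intro a b h
    rcases Sym2.eq_iff.1 h with ⟨_, h⟩ | ⟨h, _⟩
    · exact hy h
    · exact absurd (h ▸ (x a).2) (hw b)
  have : X ∩ S = (Finset.univ.filter (fun b => s((x b).1, y b) ∈ S)).image
      (fun b => s((x b).1, y b)) := by
    ext e
    simp only [Finset.mem_inter, hX, Finset.mem_image, Finset.mem_filter, Finset.mem_univ,
      true_and]
    constructor
    · rintro ⟨⟨b, rfl⟩, h⟩; exact ⟨b, h, rfl⟩
    · rintro ⟨b, h, rfl⟩; exact ⟨⟨b, rfl⟩, h⟩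
  rw [this, Finset.card_image_of_injective _ hinj, Finset.card_filter]
  push_cast
  apply Finset.sum_congr rfl
  intro b _
  unfold ind
  split_ifs <;> simp

theorem exists_partner {m n : ℕ} {M : Finset (Sym2 (TorV m n))} (hM : IsPM m n M) :
    ∃ p : TorV m n → TorV m n, (∀ v w, s(v, w) ∈ M ↔ w = p v) ∧ ∀ v, torAdj m n v (p v) := by
  have : ∀ v, ∃ w, s(v, w) ∈ M ∧ ∀ e ∈ M, v ∈ e → e = s(v, w) := by
    intro v
    obtain ⟨e, ⟨he, hv⟩, hu⟩ := hM.2 v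
    obtain ⟨w, rfl⟩ := Sym2.mem_iff_exists.1 hv
    exact ⟨w, he, fun e' he' hv' => hu e' ⟨he', hv'⟩⟩
  choose p hp hu using this
  refine ⟨p, fun v w => ⟨fun h => ?_, fun h => h ▸ hp v⟩, fun v => hM.1 _ (hp v) _ _ rfl⟩
  have := hu v _ h (Sym2.mem_mk_left v w)
  exact Sym2.congr_right.1 this

theorem exists_cycle_perm {α : Type*} [DecidableEq α] [Fintype α] (h : ℕ → α) (L : ℕ) (hL : 2 ≤ L)
    (hinj : ∀ i < L, ∀ j < L, h i = h j → i = j) (hper : ∀ i, h (i + L) = h i) :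
    ∃ τ : Equiv.Perm α, τ.IsCycle ∧ (∀ i, τ (h i) = h (i + 1)) ∧
      (∀ a, (∀ i, a ≠ h i) → τ a = a) ∧ ∀ a, a ∈ τ.support ↔ ∃ i, a = h i := by
  have hmod : ∀ i, h i = h (i % L) := by
    intro i
    have key : ∀ q r, h (r + q * L) = h r := by
      intro q
      induction q with
      | zero => intro r; simp
      | succ q ih => intro r; rw [Nat.succ_mul, ← add_assoc, hper, ih]
    conv_lhs => rw [← Nat.mod_add_div i L, mul_comm]
    exact key _ _
  let l := List.ofFn (fun i : Fin L => h i)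
  have hlen : l.length = L := by simp [l]
  have hnd : l.Nodup := by
    rw [List.nodup_ofFn]
    intro i j hij
    exact Fin.ext (hinj i i.2 j j.2 hij)
  have hmem : ∀ a, a ∈ l ↔ ∃ i, a = h i := by
    intro a
    simp only [l, List.mem_ofFn, Set.mem_range]
    constructor
    · rintro ⟨i, rfl⟩; exact ⟨i, rfl⟩
    · rintro ⟨i, rfl⟩
      exact ⟨⟨i % L, Nat.mod_lt _ (by omega)⟩, (hmod i).symm⟩
  refine ⟨l.formPerm, List.isCycle_formPerm hnd (by omega), ?_, ?_, ?_⟩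
  · intro i
    have hi : i % L < l.length := by rw [hlen]; exact Nat.mod_lt _ (by omega)
    have := List.formPerm_apply_getElem l hnd (i % L) hi
    simp only [l, List.getElem_ofFn, List.length_ofFn] at this
    rw [hmod i, this, hmod (i + 1)]
    simp [Nat.add_mod]
  · intro a ha
    apply List.formPerm_apply_of_notMem
    rw [hmem]
    rintro ⟨i, hi⟩
    exact ha i hi
  · intro a
    rw [List.support_formPerm_of_nodup l hnd, List.mem_toFinset, hmem]
    intro x hx
    rw [hx] at hlen
    simp at hlen
    omega

/-- let `Φ(M) = M ∆ U(C_M)`, where `C_M` is the first directed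
cycle of `D_{m,n}(M)` in a fixed orientation-independent order (a total order on
vertex sets).  If `M` is even (`|M ∩ A|` and `|M ∩ B|` both even), then `Φ(M)` is
odd (not both `|Φ(M) ∩ A|` and `|Φ(M) ∩ B|` even). -/
theorem phi_even_to_odd (m n : ℕ) [NeZero m] [NeZero n]
    (hm : Even m) (hn : Even n)
    (r : LinearOrder (Finset (TorV m n)))
    (M : Finset (Sym2 (TorV m n))) (hM : IsPM m n M)
    (hMA : Even (M ∩ layerA m n).card) (hMB : Even (M ∩ layerB m n).card)
    (k : ℕ) (f : ℕ → TorV m n) (hc : IsDiCycle m n M k f)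
    (hmin : ∀ S ∈ cycleVertSets m n M, r.le (cycVerts k f) S) :
    ¬ (Even ((M ∆ cycEdges k f) ∩ layerA m n).card ∧
       Even ((M ∆ cycEdges k f) ∩ layerB m n).card) := by
  classical
  have hm0 : 0 < m := NeZero.pos m
  have hn0 : 0 < n := NeZero.pos n
  have hm2 : 2 ≤ m := by obtain ⟨a, rfl⟩ := hm; omega
  have hn2 : 2 ≤ n := by obtain ⟨a, rfl⟩ := hn; omega
  rintro ⟨hA', hB'⟩
  obtain ⟨p, hp, hpadj⟩ := exists_partner hM
  have hpp : ∀ v, p (p v) = v := by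
    intro v
    have : s(p v, v) ∈ M := by rw [Sym2.eq_swap]; exact (hp v _).2 rfl
    exact ((hp _ _).1 this).symm
  obtain ⟨hk, hinj, hper, harc⟩ := hc
  have colr : ∀ {u v : TorV m n}, torAdj m n u v → (IsBlack u ↔ ¬ IsBlack v) :=
    fun h => adj_color hm hn hm2 hn2 h
  have hblack : ∀ i, IsBlack (f i) → f (i + 1) = p (f i) ∧ ¬ IsBlack (f (i + 1)) := by
    intro i hi
    rcases harc i with ⟨_, h2, h3⟩ | ⟨h1, _⟩
    · exact ⟨(hp _ _).1 h3, (colr h2).1 hi⟩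
    · exact absurd hi h1
  have hwhite : ∀ i, ¬ IsBlack (f i) → IsBlack (f (i + 1)) ∧ torAdj m n (f i) (f (i + 1)) ∧
      f (i + 1) ≠ p (f i) ∧ Collin (p (f i)) (f i) (f (i + 1)) := by
    intro i hi
    rcases harc i with ⟨h1, _⟩ | ⟨_, h2, h3, u, h4, h5⟩
    · exact absurd h1 hi
    · refine ⟨?_, h2, fun h => h3 ((hp _ _).2 h), ?_⟩
      · by_contra h; exact hi ((colr h2).2 h)
      · rw [Sym2.eq_swap] at h4
        rwa [(hp _ _).1 h4] at h5
  -- a black starting point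
  obtain ⟨s, hs1, hs⟩ : ∃ s, s ≤ 1 ∧ IsBlack (f s) := by
    by_cases h : IsBlack (f 0)
    · exact ⟨0, by omega, h⟩
    · exact ⟨1, le_refl _, (hwhite 0 h).1⟩
  have hev : ∀ i, IsBlack (f (s + 2 * i)) := by
    intro i
    induction i with
    | zero => exact hs
    | succ i ih => exact (hwhite _ (hblack _ ih).2).1
  have hod : ∀ i, ¬ IsBlack (f (s + 2 * i + 1)) := fun i => (hblack _ (hev i)).2
  obtain ⟨L, hL⟩ : ∃ L, k = 2 * L := by
    rcases Nat.even_or_odd' k with ⟨c, h | h⟩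
    · exact ⟨c, h⟩
    · exfalso
      apply hod c
      have : s + 2 * c + 1 = s + k := by omega
      rw [this, hper]
      exact hs
  let h : ℕ → BV m n := fun i => ⟨f (s + 2 * i), hev i⟩
  let g : BV m n → TorV m n := fun b => p b.1
  have hgh : ∀ i, g (h i) = f (s + 2 * i + 1) := fun i => (hblack _ (hev i)).1.symm
  have hstep : ∀ i, torAdj m n (g (h i)) (h (i + 1)).1 ∧ (h (i + 1)).1 ≠ (h i).1 ∧
      Collin (h i).1 (g (h i)) (h (i + 1)).1 := by
    intro i
    obtain ⟨_, h2, h3, h4⟩ := hwhite _ (hod i)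
    have e : p (f (s + 2 * i + 1)) = (h i).1 := by
      rw [← hgh i]; exact hpp _
    rw [e] at h3 h4
    rw [hgh]
    exact ⟨h2, h3, h4⟩
  have hhper : ∀ i, h (i + L) = h i := by
    intro i
    apply Subtype.ext
    change f (s + 2 * (i + L)) = f (s + 2 * i)
    rw [← hper (s + 2 * i)]
    congr 1
    omega
  have hL2 : 2 ≤ L := by
    by_contra hlt
    have : L = 1 := by omega
    subst this
    exact (hstep 0).2.1 (congrArg Subtype.val (hhper 0))
  have hfmod : ∀ i, f i = f (i % k) := by
    intro i
    have key : ∀ q r, f (r + q * k) = f r := by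
      intro q
      induction q with
      | zero => intro r; simp
      | succ q ih => intro r; rw [Nat.succ_mul, ← add_assoc, hper, ih]
    conv_lhs => rw [← Nat.mod_add_div i k, mul_comm]
    exact key _ _
  have hhinj : ∀ i < L, ∀ j < L, h i = h j → i = j := by
    intro i hi j hj hij
    have e : f (s + 2 * i) = f (s + 2 * j) := congrArg Subtype.val hij
    rw [hfmod, hfmod (s + 2 * j)] at e
    have e2 := hinj _ (Nat.mod_lt _ hk) _ (Nat.mod_lt _ hk) e
    have e3 : 2 * i ≡ 2 * j [MOD k] := Nat.ModEq.add_left_cancel' s e2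
    have := Nat.ModEq.eq_of_lt_of_lt e3 (by omega) (by omega)
    omega
  obtain ⟨τ, hcyc, hτ, hfix, hsupp⟩ := exists_cycle_perm h L hL2 hhinj hhper
  have G : GoodM m n g := by
    refine ⟨fun b => hpadj _, ?_, fun b => (colr (hpadj _)).1 b.2, ?_⟩
    · intro a b hab
      apply Subtype.ext
      rw [← hpp a.1, ← hpp b.1]
      exact congrArg p hab
    · intro v hv
      have : IsBlack (p v) := by
        by_contra hb; exact hv ((colr (hpadj v)).2 hb)
      exact ⟨⟨p v, this⟩, hpp v⟩
  let g' : BV m n → TorV m n := fun b => g (τ.symm b)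
  have hg' : ∀ b, g' (τ b) = g b := fun b => by simp [g']
  have hadj' : ∀ b, torAdj m n (τ b).1 (g b) := by
    intro b
    by_cases hb : ∃ i, b = h i
    · obtain ⟨i, rfl⟩ := hb
      rw [hτ]
      exact adj_symm (hstep i).1
    · push Not at hb
      rw [hfix b hb]
      exact G.adj b
  have G' : GoodM m n g' := by
    refine ⟨fun b => ?_, G.inj.comp τ.symm.injective, fun b => G.white _, fun v hv => ?_⟩
    · have := hadj' (τ.symm b)
      rwa [Equiv.apply_symm_apply] at this
    · obtain ⟨b, hb⟩ := G.surj v hv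
      exact ⟨τ b, by rw [hg', hb]⟩
  -- edge sets
  have hMmem : ∀ e, e ∈ M ↔ ∃ b : BV m n, e = s(b.1, g b) := by
    intro e
    constructor
    · intro he
      induction e using Sym2.ind with
      | _ u v =>
      by_cases hu : IsBlack u
      · exact ⟨⟨u, hu⟩, by rw [(hp _ _).1 he]⟩
      · have ad := hM.1 _ he u v rfl
        have hv : IsBlack v := by
          by_contra hb; exact hu ((colr ad).2 hb)
        rw [Sym2.eq_swap] at he ⊢
        exact ⟨⟨v, hv⟩, by rw [(hp _ _).1 he]⟩
    · rintro ⟨b, rfl⟩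
      exact (hp _ _).2 rfl
  have hUmem : ∀ e, e ∈ cycEdges k f ↔
      ∃ i, e = s((h i).1, g (h i)) ∨ e = s((h (i + 1)).1, g (h i)) := by
    intro e
    have hU : e ∈ cycEdges k f ↔ ∃ i, e = s(f i, f (i + 1)) := by
      simp only [cycEdges, Finset.mem_image, Finset.mem_range]
      constructor
      · rintro ⟨i, _, rfl⟩; exact ⟨i, rfl⟩
      · rintro ⟨i, rfl⟩
        refine ⟨i % k, Nat.mod_lt _ hk, ?_⟩
        rw [← hfmod i, hfmod (i % k + 1), hfmod (i + 1)]
        simp [Nat.add_mod]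
    rw [hU]
    constructor
    · rintro ⟨i, rfl⟩
      rw [← hper i, ← hper (i + 1)]
      obtain ⟨t, ht | ht⟩ := Nat.even_or_odd' (i + k - s)
      · refine ⟨t, Or.inl ?_⟩
        rw [hgh]
        have e1 : i + k = s + 2 * t := by omega
        have e2 : i + 1 + k = s + 2 * t + 1 := by omega
        rw [e1, e2]
      · refine ⟨t, Or.inr ?_⟩
        rw [hgh, Sym2.eq_swap]
        have e1 : i + k = s + 2 * t + 1 := by omega
        have e2 : i + 1 + k = s + 2 * (t + 1) := by omega
        rw [e1, e2]
    · rintro ⟨i, rfl | rfl⟩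
      · exact ⟨s + 2 * i, by rw [hgh]⟩
      · refine ⟨s + 2 * i + 1, ?_⟩
        rw [hgh, Sym2.eq_swap]
        rfl
  have hnotM : ∀ i, s((h (i + 1)).1, g (h i)) ∉ M := by
    intro i hi
    rw [Sym2.eq_swap] at hi
    have := (hp _ _).1 hi
    exact (hstep i).2.1 (this.trans (hpp _))
  have hM'mem : ∀ e, e ∈ M ∆ cycEdges k f ↔ ∃ b : BV m n, e = s((τ b).1, g b) := by
    intro e
    rw [Finset.mem_symmDiff]
    constructor
    · rintro (⟨h1, h2⟩ | ⟨h1, h2⟩)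
      · obtain ⟨b, rfl⟩ := (hMmem e).1 h1
        refine ⟨b, ?_⟩
        rw [hfix b]
        intro i hi
        apply h2
        rw [hUmem]
        exact ⟨i, Or.inl (by rw [hi])⟩
      · obtain ⟨i, rfl | rfl⟩ := (hUmem e).1 h1
        · exact absurd ((hMmem _).2 ⟨h i, rfl⟩) h2
        · exact ⟨h i, by rw [hτ]⟩
    · rintro ⟨b, rfl⟩
      by_cases hb : ∃ i, b = h i
      · obtain ⟨i, rfl⟩ := hb
        rw [hτ]
        exact Or.inr ⟨(hUmem _).2 ⟨i, Or.inr rfl⟩, hnotM i⟩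
      · push Not at hb
        rw [hfix b hb]
        refine Or.inl ⟨(hMmem _).2 ⟨b, rfl⟩, fun hu => ?_⟩
        obtain ⟨i, hi | hi⟩ := (hUmem _).1 hu
        · rcases Sym2.eq_iff.1 hi with ⟨h1, _⟩ | ⟨h1, _⟩
          · exact hb i (Subtype.ext h1)
          · exact G.white (h i) (h1 ▸ b.2)
        · exact hnotM i (hi ▸ (hMmem _).2 ⟨b, rfl⟩)
  have cM : ∀ S, ((M ∩ S).card : ZMod 2) = ∑ b : BV m n, (ind (s(b.1, g b) ∈ S) : ZMod 2) :=
    fun S => card_layer M S id g G.inj G.white hMmem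
  have cM' : ∀ S, (((M ∆ cycEdges k f) ∩ S).card : ZMod 2) =
      ∑ b : BV m n, (ind (s((τ b).1, g b) ∈ S) : ZMod 2) :=
    fun S => card_layer _ S τ g G.inj G.white hM'mem
  have a1 := (cM (layerA m n)).symm.trans (ZMod.natCast_eq_zero_iff_even.2 hMA)
  have a2 := (cM (layerB m n)).symm.trans (ZMod.natCast_eq_zero_iff_even.2 hMB)
  have a3 := (cM' (layerA m n)).symm.trans (ZMod.natCast_eq_zero_iff_even.2 hA')
  have a4 := (cM' (layerB m n)).symm.trans (ZMod.natCast_eq_zero_iff_even.2 hB')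
  simp only [memA, memB] at a1 a2 a3 a4
  have a3' : ∑ b : BV m n, (ind (wA m (cell b.1) (cell (g' b))) : ZMod 2) = 0 := by
    rw [← Equiv.sum_comp τ]
    simpa only [hg'] using a3
  have pt : ∀ b : BV m n, ee (cell b.1) (cell (g b)) + ee (cell (τ b).1) (cell (g b)) =
      (if b ∈ τ.support then 1 else 0) +
      (ind (wA m (cell b.1) (cell (g b))) + ind (wB n (cell b.1) (cell (g b))) +
      (ind (wA m (cell (τ b).1) (cell (g b))) + ind (wB n (cell (τ b).1) (cell (g b))))) := by
    intro b
    by_cases hb : ∃ i, b = h i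
    · rw [if_pos ((hsupp b).2 hb)]
      obtain ⟨i, rfl⟩ := hb
      rw [hτ]
      obtain ⟨h1, h2, h3⟩ := hstep i
      apply local_step hm2 hn2 (cell_lt _) (cell_lt _) (cell_lt _)
        (cell_adj hm2 hn2 (G.adj _)) (cell_adj hm2 hn2 h1)
      · rcases h3 with ⟨x1, x2⟩ | ⟨x1, x2⟩
        · exact Or.inl ⟨congrArg ZMod.val x1, congrArg ZMod.val x2⟩
        · exact Or.inr ⟨congrArg ZMod.val x1, congrArg ZMod.val x2⟩
      · intro hh
        exact h2 (cell_inj hh).symm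
    · rw [if_neg (fun hh => hb ((hsupp b).1 hh))]
      push Not at hb
      rw [hfix b hb, z2_add_self, z2_add_self, add_zero]
  have hsum : ∑ b : BV m n, (ee (cell b.1) (cell (g b)) + ee (cell (τ b).1) (cell (g b))) =
      ((τ.support.card : ℕ) : ZMod 2) := by
    rw [Finset.sum_congr rfl (fun b _ => pt b), Finset.sum_add_distrib, Finset.sum_add_distrib,
      Finset.sum_add_distrib, Finset.sum_add_distrib, a1, a2, a3, a4]
    simp only [add_zero, Finset.sum_ite_mem, Finset.univ_inter, Finset.sum_const, nsmul_eq_mul,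
      mul_one]
  have fin := core2 hm2 hn2 hn G G' a1 a3' τ hg' _ hsum
  rw [hcyc.sign] at fin
  push_cast at fin
  have hne : (-1 : ℤ) ^ τ.support.card ≠ 0 := by simp
  omega
end
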